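/- Fix an integer n ≥ 2 and a splitting type r, and set C_{k,r} = (δ(r)−δ(r)²)^{k/2}·k!/(2^{k/2}(k/2)!) for even k. There exist constants c, C > 0 depending only on n and r such that for all z ≥ 3, N > 2 and all even natural numbers k with k ≤ c·min( (z/(log z · log log z))^{1/3}, log N/log z ), one has | 𝔼_N( (Σ_{p ≤ z} Y_p(f))^k ) − C_{k,r}·π(z)^{k/2} | ≤ C·( C_{k,r}·π(z)^{k/2} · (k³/(1−δ(r))^{k/2}) · (log log z)/π(z) + z^{k(n+1)}/(N·log z) ). -/

import Mathlib

/-!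
Arithmetic statistics of families of integer `S_n`-polynomials (I. Viglino).

`𝒫_{n,N}` is the family of monic integer polynomials
`f(X) = X^n + a_{n-1}X^{n-1} + ⋯ + a_0` with `|a_i| ≤ N`, identified with their
coefficient vectors `a : Fin n → ℤ`, and `𝒫⁰_{n,N} ⊆ 𝒫_{n,N}` is the subfamily of
`f` whose splitting field over `ℚ` has Galois group isomorphic to `S_n`.
-/

open Polynomial Finset Filter

attribute [local instance] Classical.propDecidable

noncomputable section

/-- The monic integer polynomial `X^n + a_{n-1}X^{n-1} + ⋯ + a_0`. -/
def intPoly (n : ℕ) (a : Fin n → ℤ) : Polynomial ℤ :=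
  Polynomial.X ^ n + ∑ i : Fin n, Polynomial.C (a i) * Polynomial.X ^ (i : ℕ)

/-- The same polynomial viewed over `ℚ`. -/
def ratPoly (n : ℕ) (a : Fin n → ℤ) : Polynomial ℚ :=
  (intPoly n a).map (Int.castRingHom ℚ)

/-- Coefficient vectors with entries in `{-N, …, N}`: the family `𝒫_{n,N}`. -/
def coeffBox (n N : ℕ) : Finset (Fin n → ℤ) :=
  Fintype.piFinset fun _ => Finset.Icc (-(N : ℤ)) (N : ℤ)

/-- `f` is an `S_n`-polynomial: the Galois group of its splitting field `K_f` over `ℚ`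
is isomorphic to the symmetric group on `n` letters. -/
def IsSnPoly (n : ℕ) (a : Fin n → ℤ) : Prop :=
  Nonempty ((ratPoly n a).Gal ≃* Equiv.Perm (Fin n))

/-- The family `𝒫⁰_{n,N}` of `S_n`-polynomials, as a finset of coefficient vectors. -/
def P0 (n N : ℕ) : Finset (Fin n → ℤ) :=
  (coeffBox n N).filter fun a => IsSnPoly n a

/-- `ℙ_N`, the uniform probability of an event in `𝒫⁰_{n,N}`. -/
def probN (n N : ℕ) (E : (Fin n → ℤ) → Prop) : ℝ :=
  (((P0 n N).filter E).card : ℝ) / ((P0 n N).card : ℝ)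

/-- `𝔼_N`, the expectation of a real random variable on `𝒫⁰_{n,N}`. -/
def expN (n N : ℕ) (F : (Fin n → ℤ) → ℝ) : ℝ :=
  (∑ a ∈ P0 n N, F a) / ((P0 n N).card : ℝ)

/-- `π(x)`, the number of rational primes `≤ x`. -/
def primePi (x : ℝ) : ℕ :=
  ((Finset.range (⌊x⌋₊ + 1)).filter Nat.Prime).card

/-- `g ∈ 𝔽_p[X]` has splitting type `r = (r_1, …, r_n)` — encoded by `r : Fin n → ℕ` where
`r i` is `r_{i+1}`, the number of factors of degree `i+1` —, i.e. `g` is a product of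
distinct monic irreducible polynomials with exactly `r i` monic irreducible factors of
degree `i+1` for each `i`. -/
def SplitTypeOf {p : ℕ} (g : Polynomial (ZMod p)) {n : ℕ} (r : Fin n → ℕ) : Prop :=
  Squarefree g ∧ ∀ i : Fin n,
    Nat.card {h : Polynomial (ZMod p) // h.Monic ∧ Irreducible h ∧
      h.natDegree = (i : ℕ) + 1 ∧ h ∣ g} = r i

/-- `f` has splitting type `r` modulo `p`. -/
def HasSplitType (n : ℕ) (r : Fin n → ℕ) (a : Fin n → ℤ) (p : ℕ) : Prop :=
  SplitTypeOf ((intPoly n a).map (Int.castRingHom (ZMod p))) r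

/-- `π_{f,r}(x)`: the number of primes `p ≤ x` such that `f` has splitting type `r` mod `p`. -/
def countSplit (n : ℕ) (r : Fin n → ℕ) (a : Fin n → ℤ) (x : ℝ) : ℕ :=
  ((Finset.range (⌊x⌋₊ + 1)).filter fun p => p.Prime ∧ HasSplitType n r a p).card

/-- `δ(r) = ∏_{i=1}^n 1/(i^{r_i}·r_i!)`. -/
def splitDelta (n : ℕ) (r : Fin n → ℕ) : ℝ :=
  ∏ i : Fin n, (1 : ℝ) / ((((i : ℕ) + 1) ^ (r i) * Nat.factorial (r i) : ℕ) : ℝ)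

/-- `r_i` as a function of the index `i ≥ 1` (so `rget n r 1 = r_1`, etc.). -/
def rget (n : ℕ) (r : Fin n → ℕ) (i : ℕ) : ℕ :=
  if h : i - 1 < n then r ⟨i - 1, h⟩ else 0

/-- `C_r = δ(r)·r_2(r_2−1)(r_1+1)(r_1+2)/(2^{r_2+1}·r_1!·r_2!)`. -/
def splitCr (n : ℕ) (r : Fin n → ℕ) : ℝ :=
  splitDelta n r *
    ((rget n r 2 : ℝ) * ((rget n r 2 : ℝ) - 1) *
      ((rget n r 1 : ℝ) + 1) * ((rget n r 1 : ℝ) + 2)) /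
    ((2 : ℝ) ^ (rget n r 2 + 1) * (Nat.factorial (rget n r 1) : ℝ) *
      (Nat.factorial (rget n r 2) : ℝ))

/-- `|𝒳_{n,r,p}|`: the number of monic degree-`n` polynomials over `𝔽_p` that are products
of distinct monic irreducible polynomials with exactly `r_i` factors of degree `i`. -/
def Xcard (n : ℕ) (r : Fin n → ℕ) (p : ℕ) : ℕ :=
  Nat.card {g : Polynomial (ZMod p) // g.Monic ∧ g.natDegree = n ∧ SplitTypeOf g r}

/-- `Y_p(f) = 𝟙_p(f) − |𝒳_{n,r,p}|/pⁿ`. -/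
def Yp (n : ℕ) (r : Fin n → ℕ) (p : ℕ) (a : Fin n → ℤ) : ℝ :=
  (if HasSplitType n r a p then (1 : ℝ) else 0) - (Xcard n r p : ℝ) / (p : ℝ) ^ n

/-- `C_{k,r} = (δ(r)−δ(r)²)^{k/2}·k!/(2^{k/2}(k/2)!)` for even `k`. -/
def CkrEven (n : ℕ) (r : Fin n → ℕ) (k : ℕ) : ℝ :=
  (splitDelta n r - splitDelta n r ^ 2) ^ (k / 2) * (Nat.factorial k : ℝ) /
    ((2 : ℝ) ^ (k / 2) * (Nat.factorial (k / 2) : ℝ))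

/-- The partial sum up to `x ^ K` of a power series evaluated at `y`. -/
def truncEval (K : ℕ) (y : ℝ) (f : PowerSeries ℝ) : ℝ :=
  ∑ m ∈ range (K + 1), PowerSeries.coeff m f * y ^ m

lemma coeff_mul_nonneg {f g : PowerSeries ℝ} (hf : ∀ m, 0 ≤ PowerSeries.coeff m f)
    (hg : ∀ m, 0 ≤ PowerSeries.coeff m g) (m : ℕ) : 0 ≤ PowerSeries.coeff m (f * g) := by
  rw [PowerSeries.coeff_mul]
  exact sum_nonneg fun p _ => mul_nonneg (hf _) (hg _)

lemma coeff_one_nonneg (m : ℕ) : 0 ≤ PowerSeries.coeff m (1 : PowerSeries ℝ) := by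
  rw [PowerSeries.coeff_one]; split_ifs <;> norm_num

lemma coeff_prod_nonneg {ι : Type*} (s : Finset ι) {f : ι → PowerSeries ℝ}
    (hf : ∀ i ∈ s, ∀ m, 0 ≤ PowerSeries.coeff m (f i)) (m : ℕ) :
    0 ≤ PowerSeries.coeff m (∏ i ∈ s, f i) := by
  induction s using Finset.induction_on generalizing m with
  | empty => simpa using coeff_one_nonneg m
  | insert a s ha ih =>
    rw [prod_insert ha]
    exact coeff_mul_nonneg (hf a (mem_insert_self a s))
      (fun m => ih (fun i hi => hf i (mem_insert_of_mem hi)) m) m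

lemma truncEval_nonneg {K : ℕ} {y : ℝ} (hy : 0 ≤ y) {f : PowerSeries ℝ}
    (hf : ∀ m, 0 ≤ PowerSeries.coeff m f) : 0 ≤ truncEval K y f :=
  sum_nonneg fun m _ => mul_nonneg (hf m) (pow_nonneg hy m)

lemma truncEval_mul_le (K : ℕ) {y : ℝ} (hy : 0 ≤ y) {f g : PowerSeries ℝ}
    (hf : ∀ m, 0 ≤ PowerSeries.coeff m f) (hg : ∀ m, 0 ≤ PowerSeries.coeff m g) :
    truncEval K y (f * g) ≤ truncEval K y f * truncEval K y g := by
  unfold truncEval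
  rw [sum_mul_sum, ← sum_product']
  have h1 : ∀ m ∈ range (K + 1), PowerSeries.coeff m (f * g) * y ^ m =
      ∑ p ∈ antidiagonal m, PowerSeries.coeff p.1 f * y ^ p.1 *
        (PowerSeries.coeff p.2 g * y ^ p.2) := by
    intro m _
    rw [PowerSeries.coeff_mul, sum_mul]
    refine sum_congr rfl fun p hp => ?_
    rw [← mem_antidiagonal.1 hp, pow_add]; ring
  rw [sum_congr rfl h1, sum_sigma']
  have hinj : Set.InjOn (fun x : (_ : ℕ) × ℕ × ℕ => x.2)
      ((range (K + 1)).sigma fun m => antidiagonal m) := by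
    rintro ⟨m, a, b⟩ h ⟨m', a', b'⟩ h' heq
    simp only [coe_sigma, Set.mem_sigma_iff, mem_coe, HasAntidiagonal.mem_antidiagonal] at h h'
    simp only [Prod.mk.injEq] at heq
    obtain ⟨rfl, rfl⟩ := heq
    obtain rfl : m = m' := by omega
    rfl
  rw [← sum_image (f := fun p : ℕ × ℕ => PowerSeries.coeff p.1 f * y ^ p.1 *
        (PowerSeries.coeff p.2 g * y ^ p.2)) hinj]
  refine sum_le_sum_of_subset_of_nonneg ?_ fun x _ _ =>
    mul_nonneg (mul_nonneg (hf _) (pow_nonneg hy _)) (mul_nonneg (hg _) (pow_nonneg hy _))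
  rintro ⟨a, b⟩ h
  simp only [mem_image, mem_sigma, mem_range, HasAntidiagonal.mem_antidiagonal, mem_product, Sigma.exists] at h ⊢
  obtain ⟨m, h⟩ := h
  grind

lemma truncEval_one (K : ℕ) (y : ℝ) : truncEval K y 1 = 1 := by
  unfold truncEval
  rw [sum_range_succ']
  simp [PowerSeries.coeff_one]

lemma truncEval_prod_le {ι : Type*} (s : Finset ι) (K : ℕ) {y : ℝ} (hy : 0 ≤ y)
    {f : ι → PowerSeries ℝ} (hf : ∀ i ∈ s, ∀ m, 0 ≤ PowerSeries.coeff m (f i)) :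
    truncEval K y (∏ i ∈ s, f i) ≤ ∏ i ∈ s, truncEval K y (f i) := by
  induction s using Finset.induction_on with
  | empty => simp [truncEval_one]
  | insert a s ha ih =>
    rw [prod_insert ha, prod_insert ha]
    have h1 := hf a (mem_insert_self a s)
    have h2 : ∀ i ∈ s, ∀ m, 0 ≤ PowerSeries.coeff m (f i) :=
      fun i hi => hf i (mem_insert_of_mem hi)
    exact (truncEval_mul_le K hy h1 (coeff_prod_nonneg s h2)).trans
      (mul_le_mul_of_nonneg_left (ih h2) (truncEval_nonneg hy h1))

/-- `A` differs from `G` coefficientwise by at most `H - G`. -/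
def SeriesNear (A G H : PowerSeries ℝ) : Prop :=
  ∀ m, |PowerSeries.coeff m A - PowerSeries.coeff m G| ≤
    PowerSeries.coeff m H - PowerSeries.coeff m G

lemma SeriesNear.mul {A G H A' G' H' : PowerSeries ℝ} (h : SeriesNear A G H)
    (h' : SeriesNear A' G' H') (hG : ∀ m, 0 ≤ PowerSeries.coeff m G)
    (hG' : ∀ m, 0 ≤ PowerSeries.coeff m G') :
    SeriesNear (A * A') (G * G') (H * H') := by
  intro m
  simp only [PowerSeries.coeff_mul]
  rw [← sum_sub_distrib, ← sum_sub_distrib]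
  refine (abs_sum_le_sum_abs _ _).trans (sum_le_sum fun p _ => ?_)
  have h1 := h p.1
  have h2 := h' p.2
  have g1 := hG p.1
  have g2 := hG' p.2
  set a := PowerSeries.coeff p.1 A
  set g := PowerSeries.coeff p.1 G
  set b := PowerSeries.coeff p.1 H
  set a' := PowerSeries.coeff p.2 A'
  set g' := PowerSeries.coeff p.2 G'
  set b' := PowerSeries.coeff p.2 H'
  have e : a * a' - g * g' = (a - g) * (a' - g') + g * (a' - g') + (a - g) * g' := by ring
  have e' : b * b' - g * g' = (b - g) * (b' - g') + g * (b' - g') + (b - g) * g' := by ring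
  rw [e, e']
  refine (abs_add_three _ _ _).trans ?_
  rw [abs_mul, abs_mul, abs_mul, abs_of_nonneg g1, abs_of_nonneg g2]
  gcongr
  exact (abs_nonneg _).trans h1

lemma SeriesNear.prod {ι : Type*} (s : Finset ι) {A G H : ι → PowerSeries ℝ}
    (h : ∀ i ∈ s, SeriesNear (A i) (G i) (H i))
    (hG : ∀ i ∈ s, ∀ m, 0 ≤ PowerSeries.coeff m (G i)) :
    SeriesNear (∏ i ∈ s, A i) (∏ i ∈ s, G i) (∏ i ∈ s, H i) := by
  induction s using Finset.induction_on with
  | empty => intro m; simp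
  | insert a s ha ih =>
    rw [prod_insert ha, prod_insert ha, prod_insert ha]
    have h2 : ∀ i ∈ s, ∀ m, 0 ≤ PowerSeries.coeff m (G i) :=
      fun i hi => hG i (mem_insert_of_mem hi)
    exact (h a (mem_insert_self a s)).mul (ih (fun i hi => h i (mem_insert_of_mem hi)) h2)
      (hG a (mem_insert_self a s)) (coeff_prod_nonneg s h2)

/-- The power series of `exp (V x ^ 2 / 2)`. -/
def gaussSeries (V : ℝ) : PowerSeries ℝ :=
  PowerSeries.expand 2 two_ne_zero (PowerSeries.rescale (V / 2) (PowerSeries.exp ℝ))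

lemma coeff_gaussSeries_even (V : ℝ) (j : ℕ) :
    PowerSeries.coeff (2 * j) (gaussSeries V) = (V / 2) ^ j / (Nat.factorial j : ℝ) := by
  rw [gaussSeries, PowerSeries.coeff_expand_mul, PowerSeries.coeff_rescale, PowerSeries.coeff_exp]
  simp [div_eq_mul_inv]

lemma coeff_gaussSeries_odd (V : ℝ) {m : ℕ} (hm : ¬ Even m) :
    PowerSeries.coeff m (gaussSeries V) = 0 := by
  rw [gaussSeries, PowerSeries.coeff_expand_of_not_dvd]
  rwa [← even_iff_two_dvd]

lemma coeff_gaussSeries_nonneg {V : ℝ} (hV : 0 ≤ V) (m : ℕ) :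
    0 ≤ PowerSeries.coeff m (gaussSeries V) := by
  by_cases hm : Even m
  · obtain ⟨j, rfl⟩ := even_iff_two_dvd.1 hm
    rw [coeff_gaussSeries_even]; positivity
  · rw [coeff_gaussSeries_odd V hm]

lemma gaussSeries_add (U V : ℝ) : gaussSeries (U + V) = gaussSeries U * gaussSeries V := by
  rw [gaussSeries, gaussSeries, gaussSeries, ← map_mul, PowerSeries.exp_mul_exp_eq_exp_add,
    add_div]

lemma gaussSeries_zero : gaussSeries 0 = 1 := by
  simp [gaussSeries]

lemma gaussSeries_sum {ι : Type*} (s : Finset ι) (v : ι → ℝ) :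
    gaussSeries (∑ i ∈ s, v i) = ∏ i ∈ s, gaussSeries (v i) := by
  induction s using Finset.induction_on with
  | empty => simp [gaussSeries_zero]
  | insert a s ha ih => rw [sum_insert ha, prod_insert ha, gaussSeries_add, ih]

/-- The power series `1 + v (x ^ 3 + x ^ 4 + ⋯)`. -/
def tailSeries (v : ℝ) : PowerSeries ℝ :=
  PowerSeries.mk fun m => if m = 0 then 1 else if 3 ≤ m then v else 0

lemma coeff_tailSeries (v : ℝ) (m : ℕ) : PowerSeries.coeff m (tailSeries v) =
    if m = 0 then 1 else if 3 ≤ m then v else 0 := by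
  simp [tailSeries]

lemma coeff_tailSeries_nonneg {v : ℝ} (hv : 0 ≤ v) (m : ℕ) :
    0 ≤ PowerSeries.coeff m (tailSeries v) := by
  rw [coeff_tailSeries]; split_ifs <;> positivity

lemma truncEval_tailSeries_le {v : ℝ} (hv : 0 ≤ v) (K : ℕ) {y : ℝ} (hy : 0 ≤ y)
    (hy2 : y ≤ 1 / 2) : truncEval K y (tailSeries v) ≤ Real.exp (2 * v * y ^ 3) := by
  have key : truncEval K y (tailSeries v) ≤ 1 + v * (2 * y ^ 3) := by
    have hgeo : ∀ L : ℕ, ∑ m ∈ range L, y ^ m ≤ 2 := by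
      intro L
      have h1 := geom_sum_mul y L
      have h2 : (0 : ℝ) ≤ ∑ m ∈ range L, y ^ m := sum_nonneg fun m _ => pow_nonneg hy m
      nlinarith [pow_nonneg hy L]
    have hstep : truncEval K y (tailSeries v) ≤ truncEval (K + 3) y (tailSeries v) := by
      refine sum_le_sum_of_subset_of_nonneg (range_subset_range.2 (by omega)) fun m _ _ => ?_
      exact mul_nonneg (coeff_tailSeries_nonneg hv m) (pow_nonneg hy m)
    refine hstep.trans ?_
    unfold truncEval
    rw [show K + 3 + 1 = 3 + (K + 1) by ring, sum_range_add]
    simp only [coeff_tailSeries]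
    have : ∀ m, (if 3 + m = 0 then (1 : ℝ) else if 3 ≤ 3 + m then v else 0) * y ^ (3 + m) =
        v * y ^ 3 * y ^ m := by
      intro m
      rw [if_neg (by omega), if_pos (by omega), pow_add]; ring
    simp only [this, ← mul_sum]
    simp only [sum_range_succ, sum_range_zero]
    norm_num
    nlinarith [hgeo (K + 1), mul_nonneg hv (pow_nonneg hy 3), sum_range_succ (fun m => y ^ m) K]
  refine key.trans ?_
  have := Real.add_one_le_exp (2 * v * y ^ 3)
  linarith

lemma coeff_prod_tailSeries {ι : Type*} (s : Finset ι) (v : ι → ℝ) :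
    PowerSeries.coeff 0 (∏ i ∈ s, tailSeries (v i)) = 1 ∧
    PowerSeries.coeff 1 (∏ i ∈ s, tailSeries (v i)) = 0 ∧
    PowerSeries.coeff 2 (∏ i ∈ s, tailSeries (v i)) = 0 ∧
    PowerSeries.coeff 3 (∏ i ∈ s, tailSeries (v i)) = ∑ i ∈ s, v i ∧
    PowerSeries.coeff 4 (∏ i ∈ s, tailSeries (v i)) = ∑ i ∈ s, v i := by
  induction s using Finset.induction_on with
  | empty => simp [PowerSeries.coeff_one]
  | insert a s ha ih =>
    obtain ⟨h0, h1, h2, h3, h4⟩ := ih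
    rw [prod_insert ha, sum_insert ha]
    generalize hF : ∏ i ∈ s, tailSeries (v i) = F at *
    refine ⟨?_, ?_, ?_, ?_, ?_⟩ <;>
    · simp only [PowerSeries.coeff_mul, Finset.Nat.antidiagonal_succ, Finset.Nat.antidiagonal_zero,
        sum_cons, map_singleton, sum_singleton, coeff_tailSeries, map_cons,
        Function.Embedding.prodMap, Function.Embedding.coeFn_mk, Prod.map,
        Function.Embedding.refl_apply]
      norm_num [h0, h1, h2, h3, h4]
      try ring

/-- `A` has the shape of the exponential moment generating series of a centred variable with
variance `v` that is bounded by one. -/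
structure IsMomentSeries (v : ℝ) (A : PowerSeries ℝ) : Prop where
  coeff_zero : PowerSeries.coeff 0 A = 1
  coeff_one : PowerSeries.coeff 1 A = 0
  coeff_two : PowerSeries.coeff 2 A = v / 2
  abs_coeff_le : ∀ m, 3 ≤ m → |PowerSeries.coeff m A| ≤ v / 2

lemma coeff_gauss_mul_tail_sub {v : ℝ} (hv : 0 ≤ v) (m : ℕ) :
    (if 3 ≤ m then v else 0) ≤ PowerSeries.coeff m (gaussSeries v * tailSeries v) -
      PowerSeries.coeff m (gaussSeries v) := by
  have hG0 : PowerSeries.coeff 0 (gaussSeries v) = 1 := by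
    simpa using coeff_gaussSeries_even v 0
  by_cases h0 : m = 0
  · subst h0
    simp [PowerSeries.coeff_mul, coeff_tailSeries, hG0]
  rw [PowerSeries.coeff_mul, Finset.Nat.sum_antidiagonal_eq_sum_range_succ_mk, sum_range_succ]
  simp only [Nat.sub_self]
  rw [coeff_tailSeries, if_pos rfl, mul_one, add_sub_cancel_right]
  refine le_trans ?_ (single_le_sum (f := fun k => PowerSeries.coeff k (gaussSeries v) *
    PowerSeries.coeff (m - k) (tailSeries v)) (fun k _ => mul_nonneg
    (coeff_gaussSeries_nonneg hv k) (coeff_tailSeries_nonneg hv _))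
    (mem_range.2 (Nat.pos_of_ne_zero h0)))
  simp [hG0, coeff_tailSeries, h0]

lemma IsMomentSeries.near {v : ℝ} (hv : 0 ≤ v) (hv1 : v ≤ 1) {A : PowerSeries ℝ}
    (hA : IsMomentSeries v A) :
    SeriesNear A (gaussSeries v) (gaussSeries v * tailSeries v) := by
  intro m
  refine le_trans ?_ (coeff_gauss_mul_tail_sub hv m)
  have h0 : PowerSeries.coeff 0 (gaussSeries v) = 1 := by
    simpa using coeff_gaussSeries_even v 0
  have h1 : PowerSeries.coeff 1 (gaussSeries v) = 0 := coeff_gaussSeries_odd v (by decide)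
  have h2 : PowerSeries.coeff 2 (gaussSeries v) = v / 2 := by
    simpa using coeff_gaussSeries_even v 1
  rcases Nat.lt_or_ge m 3 with hm | hm
  · interval_cases m
    · simp [hA.coeff_zero, h0]
    · simp [hA.coeff_one, h1]
    · simp [hA.coeff_two, h2]
  rw [if_pos hm]
  have hG : PowerSeries.coeff m (gaussSeries v) ≤ v / 2 := by
    by_cases he : Even m
    · obtain ⟨j, rfl⟩ := even_iff_two_dvd.1 he
      rw [coeff_gaussSeries_even]
      have hj : 1 ≤ j := by omega
      have e1 : (v / 2) ^ j ≤ v / 2 := by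
        calc (v / 2) ^ j ≤ (v / 2) ^ 1 :=
              pow_le_pow_of_le_one (by linarith) (by linarith) hj
          _ = v / 2 := pow_one _
      have e2 : (1 : ℝ) ≤ (Nat.factorial j : ℝ) := by exact_mod_cast Nat.factorial_pos j
      exact (div_le_self (by positivity) e2).trans e1
    · rw [coeff_gaussSeries_odd v he]; linarith
  have hGn := coeff_gaussSeries_nonneg hv m
  have := abs_le.1 (hA.abs_coeff_le m hm)
  rw [abs_le]
  constructor <;> linarith [this.1, this.2]

lemma coeff_two_prod {ι : Type*} (s : Finset ι) {v : ι → ℝ} {A : ι → PowerSeries ℝ}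
    (hA : ∀ i ∈ s, IsMomentSeries (v i) (A i)) :
    PowerSeries.coeff 0 (∏ i ∈ s, A i) = 1 ∧ PowerSeries.coeff 1 (∏ i ∈ s, A i) = 0 ∧
    PowerSeries.coeff 2 (∏ i ∈ s, A i) = (∑ i ∈ s, v i) / 2 := by
  induction s using Finset.induction_on with
  | empty => simp [PowerSeries.coeff_one]
  | insert a s ha ih =>
    obtain ⟨h0, h1, h2⟩ := ih fun i hi => hA i (mem_insert_of_mem hi)
    have h := hA a (mem_insert_self a s)
    rw [prod_insert ha, sum_insert ha]
    generalize hF : ∏ i ∈ s, A i = F at *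
    refine ⟨?_, ?_, ?_⟩ <;>
    · simp only [PowerSeries.coeff_mul, Finset.Nat.antidiagonal_succ, Finset.Nat.antidiagonal_zero,
        sum_cons, map_singleton, sum_singleton, map_cons,
        Function.Embedding.prodMap, Function.Embedding.coeFn_mk, Prod.map,
        Function.Embedding.refl_apply]
      norm_num [h0, h1, h2, h.coeff_zero, h.coeff_one, h.coeff_two]
      try ring

lemma gauss_coeff_shift {V : ℝ} (hV : 0 < V) {j s : ℕ} (hs : s ≤ j) :
    (V / 2) ^ (j - s) / (Nat.factorial (j - s) : ℝ) ≤
      (V / 2) ^ j / (Nat.factorial j : ℝ) * ((2 * j : ℕ) / V) ^ s := by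
  have h1 : ((Nat.factorial j : ℕ) : ℝ) ≤ (j : ℝ) ^ s * (Nat.factorial (j - s) : ℝ) := by
    have e := Nat.factorial_mul_descFactorial hs
    have e2 := Nat.descFactorial_le_pow j s
    have : Nat.factorial j ≤ j ^ s * Nat.factorial (j - s) := by
      rw [← e, mul_comm]; gcongr
    exact_mod_cast this
  have e : (V / 2) ^ j = (V / 2) ^ (j - s) * (V / 2) ^ s := by
    rw [← pow_add, Nat.sub_add_cancel hs]
  have hj : (0 : ℝ) < (Nat.factorial j : ℝ) := by exact_mod_cast Nat.factorial_pos j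
  have hjs : (0 : ℝ) < (Nat.factorial (j - s) : ℝ) := by
    exact_mod_cast Nat.factorial_pos (j - s)
  have e3 : (V / 2) ^ s * ((2 * j : ℕ) / V) ^ s = (j : ℝ) ^ s := by
    rw [← mul_pow]; congr 1; push_cast; field_simp
  rw [e, div_le_iff₀ hjs]
  have e4 : (V / 2) ^ (j - s) * (V / 2) ^ s / (Nat.factorial j : ℝ) * ((2 * j : ℕ) / V) ^ s *
      (Nat.factorial (j - s) : ℝ) = (V / 2) ^ (j - s) *
        ((j : ℝ) ^ s * (Nat.factorial (j - s) : ℝ) / (Nat.factorial j : ℝ)) := by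
    rw [← e3]; ring
  rw [e4]
  refine le_mul_of_one_le_right (by positivity) ?_
  rw [le_div_iff₀ hj, one_mul]
  exact h1

lemma coeff_prod_moment_near {ι : Type*} (S : Finset ι) {v : ι → ℝ} {A : ι → PowerSeries ℝ}
    (hv : ∀ i ∈ S, 0 ≤ v i) (hv1 : ∀ i ∈ S, v i ≤ 1)
    (hA : ∀ i ∈ S, IsMomentSeries (v i) (A i)) {V : ℝ} (hVdef : V = ∑ i ∈ S, v i) (hV8 : 8 ≤ V)
    {j : ℕ} (hj : 1 ≤ j) (hjV : ((2 * j : ℕ) : ℝ) ^ 3 ≤ V) :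
    |PowerSeries.coeff (2 * j) (∏ i ∈ S, A i) - (V / 2) ^ j / (Nat.factorial j : ℝ)| ≤
      9 * (((2 * j : ℕ) : ℝ) ^ 3 / V) * ((V / 2) ^ j / (Nat.factorial j : ℝ)) := by
  have hVpos : 0 < V := by linarith
  set k : ℕ := 2 * j with hk
  set g : ℝ := (V / 2) ^ j / (Nat.factorial j : ℝ) with hg
  have hgpos : 0 < g := by positivity
  have hnear := SeriesNear.prod S (fun i hi => (hA i hi).near (hv i hi) (hv1 i hi))
    (fun i hi => coeff_gaussSeries_nonneg (hv i hi)) k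
  rw [prod_mul_distrib, ← gaussSeries_sum, ← hVdef] at hnear
  obtain ⟨h0, h1, h2, h3, h4⟩ := coeff_prod_tailSeries S v
  rw [← hVdef] at h3 h4
  set E := ∏ i ∈ S, tailSeries (v i) with hE
  have hEn : ∀ m, 0 ≤ PowerSeries.coeff m E :=
    coeff_prod_nonneg S fun i hi => coeff_tailSeries_nonneg (hv i hi)
  have hcg : PowerSeries.coeff k (gaussSeries V) = g := coeff_gaussSeries_even V j
  rw [hcg] at hnear
  refine hnear.trans ?_
  set ρ : ℝ := V ^ (-(1 / 3) : ℝ) with hρ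
  have hρpos : 0 < ρ := Real.rpow_pos_of_pos hVpos _
  have hρ3 : ρ ^ 3 * V = 1 := by
    rw [hρ, ← Real.rpow_natCast, ← Real.rpow_mul hVpos.le]
    norm_num
    rw [Real.rpow_neg_one]; field_simp
  have hρhalf : ρ ≤ 1 / 2 := by
    by_contra hcon
    push Not at hcon
    have : (1 / 2 : ℝ) ^ 3 < ρ ^ 3 := by gcongr
    nlinarith
  have hkρ : (k : ℝ) * ρ ≤ 1 := by
    have : ((k : ℝ) * ρ) ^ 3 ≤ 1 := by
      rw [mul_pow]
      calc (k : ℝ) ^ 3 * ρ ^ 3 ≤ V * ρ ^ 3 := by gcongr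
        _ = 1 := by rw [mul_comm]; exact hρ3
    by_contra hcon
    push Not at hcon
    have h' : (1 : ℝ) ^ 3 < ((k : ℝ) * ρ) ^ 3 := by gcongr
    linarith
  have hkpos : (0 : ℝ) < k := by exact_mod_cast (by omega : 0 < k)
  have htrunc : truncEval k ρ E ≤ 8 := by
    refine (truncEval_prod_le S k hρpos.le fun i hi => coeff_tailSeries_nonneg (hv i hi)).trans ?_
    refine (prod_le_prod (fun i hi => truncEval_nonneg hρpos.le
      (coeff_tailSeries_nonneg (hv i hi))) fun i hi =>
      truncEval_tailSeries_le (hv i hi) k hρpos.le hρhalf).trans ?_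
    rw [← Real.exp_sum, ← sum_mul, ← mul_sum, ← hVdef,
      show 2 * V * ρ ^ 3 = 1 + 1 by linarith, Real.exp_add]
    have := Real.exp_one_lt_d9
    have := Real.exp_pos 1
    nlinarith
  have hk1 : (1 : ℝ) ≤ k := by exact_mod_cast (by omega : 1 ≤ k)
  have hterm : ∀ m ∈ range (k + 1), m ≠ 0 →
      PowerSeries.coeff m E * PowerSeries.coeff (k - m) (gaussSeries V) ≤
        PowerSeries.coeff m E * ρ ^ m * ((k : ℝ) ^ 3 / V * g) +
          (if m = 4 then (k : ℝ) ^ 3 / V * g else 0) := by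
    intro m hm hm0
    have hmk : m ≤ k := by simpa [Nat.lt_succ_iff] using hm
    have hfirst : 0 ≤ PowerSeries.coeff m E * ρ ^ m * ((k : ℝ) ^ 3 / V * g) := by
      have := hEn m
      positivity
    have hsecond : 0 ≤ (if m = 4 then (k : ℝ) ^ 3 / V * g else 0) := by
      split_ifs <;> positivity
    by_cases he : Even m
    swap
    · rw [coeff_gaussSeries_odd V (by rw [Nat.even_sub hmk]; simp [he, hk]), mul_zero]
      linarith
    obtain ⟨s, rfl⟩ := even_iff_two_dvd.1 he
    have hsj : s ≤ j := by omega
    have hgc : PowerSeries.coeff (k - 2 * s) (gaussSeries V) ≤ g * ((k : ℝ) / V) ^ s := by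
      rw [show k - 2 * s = 2 * (j - s) by omega, coeff_gaussSeries_even]
      exact gauss_coeff_shift hVpos hsj
    have hs0 : s ≠ 0 := by rintro rfl; exact hm0 rfl
    have hcases : s = 1 ∨ s = 2 ∨ 3 ≤ s := by omega
    rcases hcases with rfl | rfl | hs3
    · rw [show 2 * 1 = 2 by norm_num] at *
      rw [h2, zero_mul]; rw [h2] at hfirst; linarith
    · rw [show 2 * 2 = 4 by norm_num] at *
      rw [if_pos rfl]
      have : PowerSeries.coeff 4 E * PowerSeries.coeff (k - 4) (gaussSeries V) ≤
          (k : ℝ) ^ 3 / V * g := by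
        rw [h4]
        calc V * PowerSeries.coeff (k - 4) (gaussSeries V) ≤ V * (g * ((k : ℝ) / V) ^ 2) := by
              gcongr
          _ = (k : ℝ) ^ 2 / V * g := by field_simp
          _ ≤ (k : ℝ) ^ 3 / V * g := by
              gcongr ?_ / V * g
              exact pow_le_pow_right₀ hk1 (by norm_num)
      linarith
    · have hρs : ((k : ℝ) / V) ^ s = ρ ^ (2 * s) * ((k : ℝ) * ρ) ^ s := by
        rw [pow_mul, ← mul_pow]
        congr 1
        have : ρ ^ 3 = 1 / V := by field_simp; exact hρ3
        calc (k : ℝ) / V = k * (1 / V) := by ring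
          _ = ρ ^ 2 * (k * ρ) := by rw [← this]; ring
      have hkρ3 : ((k : ℝ) * ρ) ^ s ≤ (k : ℝ) ^ 3 / V := by
        calc ((k : ℝ) * ρ) ^ s ≤ ((k : ℝ) * ρ) ^ 3 :=
              pow_le_pow_of_le_one (by positivity) hkρ hs3
          _ = (k : ℝ) ^ 3 / V := by
              rw [mul_pow, eq_div_iff hVpos.ne', mul_assoc, hρ3, mul_one]
      have : PowerSeries.coeff (2 * s) E * PowerSeries.coeff (k - 2 * s) (gaussSeries V) ≤
          PowerSeries.coeff (2 * s) E * ρ ^ (2 * s) * ((k : ℝ) ^ 3 / V * g) := by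
        have hEs := hEn (2 * s)
        calc PowerSeries.coeff (2 * s) E * PowerSeries.coeff (k - 2 * s) (gaussSeries V)
            ≤ PowerSeries.coeff (2 * s) E * (g * (ρ ^ (2 * s) * ((k : ℝ) ^ 3 / V))) := by
              gcongr
              refine hgc.trans ?_
              rw [hρs]; gcongr
          _ = _ := by ring
      linarith
  rw [mul_comm (gaussSeries V), PowerSeries.coeff_mul,
    Finset.Nat.sum_antidiagonal_eq_sum_range_succ_mk, sum_range_succ']
  simp only [h0, one_mul, Nat.sub_zero, hcg, add_sub_cancel_right]
  calc ∑ m ∈ range k, PowerSeries.coeff (m + 1) E *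
        PowerSeries.coeff (k - (m + 1)) (gaussSeries V)
      ≤ ∑ m ∈ range k, (PowerSeries.coeff (m + 1) E * ρ ^ (m + 1) * ((k : ℝ) ^ 3 / V * g) +
          (if m + 1 = 4 then (k : ℝ) ^ 3 / V * g else 0)) :=
        sum_le_sum fun m hm => hterm (m + 1) (by simpa using hm) (by omega)
    _ ≤ truncEval k ρ E * ((k : ℝ) ^ 3 / V * g) + (k : ℝ) ^ 3 / V * g := by
        rw [sum_add_distrib, ← sum_mul]
        gcongr
        · unfold truncEval
          rw [sum_range_succ']
          simp [h0]
        · simp only [Nat.reduceEqDiff, sum_ite_eq']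
          split_ifs
          · exact le_rfl
          · positivity
    _ ≤ 8 * ((k : ℝ) ^ 3 / V * g) + (k : ℝ) ^ 3 / V * g := by gcongr
    _ = _ := by ring

/-- `F a` depends only on `a` modulo `q`. -/
def PeriodicMod {R : Type*} (n : ℕ) (q : ℕ) (F : (Fin n → ℤ) → R) : Prop :=
  ∀ a b : Fin n → ℤ, (∀ i, a i ≡ b i [ZMOD q]) → F a = F b

lemma PeriodicMod.of_dvd {R : Type*} {n q q' : ℕ} {F : (Fin n → ℤ) → R} (h : PeriodicMod n q F)
    (hq : q ∣ q') : PeriodicMod n q' F :=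
  fun a b hab => h a b fun i => (hab i).of_dvd (Int.natCast_dvd_natCast.2 hq)

/-- The residue cube `{0, …, q - 1}ⁿ`. -/
def cube (n q : ℕ) : Finset (Fin n → ℤ) := Fintype.piFinset fun _ => Ico 0 (q : ℤ)

lemma mem_cube {n q : ℕ} {a : Fin n → ℤ} : a ∈ cube n q ↔ ∀ i, 0 ≤ a i ∧ a i < q := by
  simp [cube]

lemma card_cube (n q : ℕ) : (cube n q).card = q ^ n := by
  simp [cube, Fintype.card_piFinset]

lemma card_filter_emod {q L : ℕ} (hq : 0 < q) (b x : ℤ) (hx : 0 ≤ x ∧ x < q) :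
    ((Ico b (b + q * L)).filter fun y => y % q = x).card = L := by
  have h := Int.Ico_filter_modEq_card b (b + q * L) (r := (q : ℤ)) (by exact_mod_cast hq) x
  have e : ((Ico b (b + q * L)).filter fun y => y % q = x) =
      ((Ico b (b + q * L)).filter fun y => y ≡ x [ZMOD q]) := by
    refine filter_congr fun y _ => ?_
    rw [Int.ModEq, Int.emod_eq_of_lt hx.1 hx.2]
  rw [e]
  have hq' : (q : ℚ) ≠ 0 := by exact_mod_cast hq.ne'
  have e2 : (((b + q * L : ℤ) : ℚ) - (x : ℚ)) / ((q : ℤ) : ℚ) =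
      ((b : ℚ) - x) / ((q : ℤ) : ℚ) + (L : ℤ) := by
    push_cast; field_simp; ring
  rw [e2, Int.ceil_add_intCast] at h
  have : (0 : ℤ) ≤ L := by positivity
  zify
  rw [h]; simp

lemma sum_box_periodic {R : Type*} [CommRing R] {n q : ℕ} (hq : 0 < q) {F : (Fin n → ℤ) → R}
    (hF : PeriodicMod n q F) (b : ℤ) (L : ℕ) :
    ∑ a ∈ Fintype.piFinset (fun _ : Fin n => Ico b (b + q * L)), F a =
      (L : R) ^ n * ∑ a ∈ cube n q, F a := by
  have hq' : (0 : ℤ) < q := by exact_mod_cast hq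
  have hmaps : ∀ a ∈ Fintype.piFinset (fun _ : Fin n => Ico b (b + q * L)),
      (fun i => a i % (q : ℤ)) ∈ cube n q := by
    intro a _
    rw [mem_cube]
    exact fun i => ⟨Int.emod_nonneg _ hq'.ne', Int.emod_lt_of_pos _ hq'⟩
  rw [← sum_fiberwise_of_maps_to hmaps, mul_sum]
  refine sum_congr rfl fun w hw => ?_
  have h1 : ∀ a ∈ (Fintype.piFinset (fun _ : Fin n => Ico b (b + q * L))).filter
      (fun a => (fun i => a i % (q : ℤ)) = w), F a = F w := by
    intro a ha
    refine hF a w fun i => ?_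
    have := (mem_filter.1 ha).2
    rw [Int.ModEq, ← this]
    simp
  rw [sum_congr rfl h1, sum_const, nsmul_eq_mul]
  congr 1
  have h2 : (Fintype.piFinset (fun _ : Fin n => Ico b (b + q * L))).filter
      (fun a => (fun i => a i % (q : ℤ)) = w) =
      Fintype.piFinset (fun i : Fin n => (Ico b (b + q * L)).filter fun y => y % q = w i) := by
    ext a
    simp only [mem_filter, Fintype.mem_piFinset, funext_iff]
    exact forall_and.symm
  rw [h2, Fintype.card_piFinset, prod_congr rfl fun i _ =>
    card_filter_emod hq b (w i) (mem_cube.1 hw i)]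
  simp

lemma sum_cube_periodic {R : Type*} [CommRing R] {n q q' : ℕ} (hq : 0 < q)
    {F : (Fin n → ℤ) → R} (hF : PeriodicMod n q F) (h : q ∣ q') :
    ∑ a ∈ cube n q', F a = ((q' / q : ℕ) : R) ^ n * ∑ a ∈ cube n q, F a := by
  have := sum_box_periodic hq hF 0 (q' / q)
  rw [← this, cube]
  congr 2
  funext i
  congr 1
  rw [zero_add]
  exact_mod_cast (Nat.mul_div_cancel' h).symm

lemma sum_cube_mul {R : Type*} [CommRing R] {n p q : ℕ} (hp : 0 < p) (hq : 0 < q)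
    (hpq : p.Coprime q) {F G : (Fin n → ℤ) → R} (hF : PeriodicMod n p F)
    (hG : PeriodicMod n q G) :
    ∑ a ∈ cube n (p * q), F a * G a = (∑ a ∈ cube n p, F a) * ∑ a ∈ cube n q, G a := by
  have hp' : (0 : ℤ) < p := by exact_mod_cast hp
  have hq' : (0 : ℤ) < q := by exact_mod_cast hq
  rw [sum_mul_sum, ← sum_product']
  set φ : (Fin n → ℤ) → (Fin n → ℤ) × (Fin n → ℤ) :=
    fun a => (fun i => a i % (p : ℤ), fun i => a i % (q : ℤ)) with hφ
  have hmaps : ∀ a ∈ cube n (p * q), φ a ∈ cube n p ×ˢ cube n q := by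
    intro a _
    rw [mem_product, mem_cube, mem_cube]
    exact ⟨fun i => ⟨Int.emod_nonneg _ hp'.ne', Int.emod_lt_of_pos _ hp'⟩,
      fun i => ⟨Int.emod_nonneg _ hq'.ne', Int.emod_lt_of_pos _ hq'⟩⟩
  have hinj : Set.InjOn φ (cube n (p * q)) := by
    intro a ha b hb hab
    simp only [hφ, Prod.mk.injEq, funext_iff] at hab
    funext i
    have h1 : a i ≡ b i [ZMOD (p * q : ℕ)] := by
      push_cast
      exact (Int.modEq_and_modEq_iff_modEq_mul (by simpa using hpq)).1 ⟨hab.1 i, hab.2 i⟩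
    have ha' := mem_cube.1 ha i
    have hb' := mem_cube.1 hb i
    rwa [Int.ModEq, Int.emod_eq_of_lt ha'.1 ha'.2, Int.emod_eq_of_lt hb'.1 hb'.2] at h1
  have hsurj : Set.SurjOn φ (cube n (p * q)) (cube n p ×ˢ cube n q : Finset _) := by
    refine surjOn_of_injOn_of_card_le φ hmaps hinj ?_
    rw [card_product, card_cube, card_cube, card_cube, mul_pow]
  refine sum_nbij φ hmaps hinj hsurj fun a _ => ?_
  congr 1
  · exact hF _ _ fun i => by simp [hφ, Int.ModEq]
  · exact hG _ _ fun i => by simp [hφ, Int.ModEq]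

lemma PeriodicMod.prod {R ι : Type*} [CommRing R] {n : ℕ} {q : ι → ℕ} (S : Finset ι)
    {F : ι → (Fin n → ℤ) → R} (hF : ∀ p ∈ S, PeriodicMod n (q p) (F p)) {Q : ℕ}
    (hQ : ∀ p ∈ S, q p ∣ Q) :
    PeriodicMod n Q fun a => ∏ p ∈ S, F p a :=
  fun a b hab => prod_congr rfl fun p hp => (hF p hp).of_dvd (hQ p hp) a b hab

lemma sum_cube_prod {R : Type*} [CommRing R] {n : ℕ} (S : Finset ℕ) (hS : ∀ p ∈ S, p.Prime)
    {F : ℕ → (Fin n → ℤ) → R} (hF : ∀ p ∈ S, PeriodicMod n p (F p)) :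
    ∑ a ∈ cube n (∏ p ∈ S, p), ∏ p ∈ S, F p a = ∏ p ∈ S, ∑ a ∈ cube n p, F p a := by
  induction S using Finset.induction_on with
  | empty =>
    have h := card_cube n 1
    simp only [prod_empty, sum_const, h]
    simp
  | insert p S hp ih =>
    have hS' : ∀ p ∈ S, p.Prime := fun q hq => hS q (mem_insert_of_mem hq)
    have hF' : ∀ p ∈ S, PeriodicMod n p (F p) := fun q hq => hF q (mem_insert_of_mem hq)
    rw [prod_insert hp, prod_insert hp, ← ih hS' hF', ← sum_cube_mul]
    · exact sum_congr rfl fun a _ => prod_insert hp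
    · exact (hS p (mem_insert_self p S)).pos
    · exact prod_pos fun q hq => (hS' q hq).pos
    · refine Nat.Coprime.prod_right fun q hq => ?_
      rw [Nat.coprime_primes (hS p (mem_insert_self p S)) (hS' q hq)]
      rintro rfl; exact hp hq
    · exact hF p (mem_insert_self p S)
    · exact PeriodicMod.prod S hF' fun q hq => dvd_prod_of_mem _ hq

/-- The exponential moment generating series of `Y` on the residue cube modulo `p`. -/
def cubeSeries (n p : ℕ) (Y : (Fin n → ℤ) → ℝ) : PowerSeries ℝ :=
  PowerSeries.C (((p : ℝ) ^ n)⁻¹) *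
    ∑ a ∈ cube n p, PowerSeries.rescale (Y a) (PowerSeries.exp ℝ)

lemma coeff_cubeSeries (n p : ℕ) (Y : (Fin n → ℤ) → ℝ) (m : ℕ) :
    PowerSeries.coeff m (cubeSeries n p Y) =
      (∑ a ∈ cube n p, Y a ^ m) / (p : ℝ) ^ n / (Nat.factorial m : ℝ) := by
  rw [cubeSeries, PowerSeries.coeff_C_mul, map_sum]
  simp only [PowerSeries.coeff_rescale, PowerSeries.coeff_exp]
  rw [← sum_mul]
  simp only [map_div₀, map_one, map_natCast]
  field_simp

lemma prod_rescale_exp {ι : Type*} (S : Finset ι) (y : ι → ℝ) :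
    ∏ i ∈ S, PowerSeries.rescale (y i) (PowerSeries.exp ℝ) =
      PowerSeries.rescale (∑ i ∈ S, y i) (PowerSeries.exp ℝ) := by
  induction S using Finset.induction_on with
  | empty => simp
  | insert a s ha ih =>
    rw [prod_insert ha, sum_insert ha, ih, PowerSeries.exp_mul_exp_eq_exp_add]

lemma cube_moment_eq {n : ℕ} (S : Finset ℕ) (hS : ∀ p ∈ S, p.Prime)
    {Y : ℕ → (Fin n → ℤ) → ℝ} (hY : ∀ p ∈ S, PeriodicMod n p (Y p)) (k : ℕ) :
    (∑ a ∈ cube n (∏ p ∈ S, p), (∑ p ∈ S, Y p a) ^ k) / ((∏ p ∈ S, p : ℕ) : ℝ) ^ n =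
      (Nat.factorial k : ℝ) * PowerSeries.coeff k (∏ p ∈ S, cubeSeries n p (Y p)) := by
  have h1 : ∏ p ∈ S, cubeSeries n p (Y p) =
      cubeSeries n (∏ p ∈ S, p) fun a => ∑ p ∈ S, Y p a := by
    simp only [cubeSeries]
    rw [prod_mul_distrib, ← sum_cube_prod S hS
      (F := fun p a => PowerSeries.rescale (Y p a) (PowerSeries.exp ℝ))
      (fun p hp a b hab => by simp only [hY p hp a b hab]), ← map_prod]
    congr 2
    · rw [Nat.cast_prod, ← prod_pow, prod_inv_distrib]
    · exact funext fun a => prod_rescale_exp S _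
  rw [h1, coeff_cubeSeries]
  field_simp

/-- The average of `F` over the coefficient box. -/
def boxAvg (n N : ℕ) (F : (Fin n → ℤ) → ℝ) : ℝ :=
  (∑ a ∈ coeffBox n N, F a) / (2 * N + 1 : ℝ) ^ n

lemma card_coeffBox (n N : ℕ) : ((coeffBox n N).card : ℝ) = (2 * N + 1 : ℝ) ^ n := by
  rw [coeffBox, Fintype.card_piFinset]
  simp only [Int.card_Icc, prod_const, card_univ, Fintype.card_fin]
  rw [show ((N : ℤ) + 1 - -(N : ℤ)).toNat = 2 * N + 1 by omega]
  push_cast; rfl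

lemma boxAvg_periodic {n N q : ℕ} (hN : 0 < N) (hq : 0 < q) {F : (Fin n → ℤ) → ℝ}
    (hF : PeriodicMod n q F) (hF1 : ∀ a, |F a| ≤ 1) :
    |boxAvg n N F - (∑ a ∈ cube n q, F a) / (q : ℝ) ^ n| ≤ n * q / N := by
  set B : ℝ := 2 * N + 1 with hB
  have hBpos : 0 < B := by positivity
  set L : ℕ := (2 * N + 1) / q with hL
  have hqL : q * L ≤ 2 * N + 1 := Nat.mul_div_le _ _
  have hqL' : 2 * N + 1 < q * L + q := by
    have := Nat.lt_mul_div_succ (2 * N + 1) hq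
    rw [mul_add, mul_one] at this
    exact this
  set I : Finset (Fin n → ℤ) :=
    Fintype.piFinset (fun _ : Fin n => Ico (-(N : ℤ)) (-(N : ℤ) + q * L)) with hI
  have hsub : I ⊆ coeffBox n N := by
    refine Fintype.piFinset_subset _ _ fun _ => ?_
    intro y hy
    have h : (q : ℤ) * L ≤ 2 * N + 1 := by exact_mod_cast hqL
    simp only [mem_Ico, mem_Icc] at hy ⊢
    constructor
    · exact hy.1
    · linarith [hy.2]
  have hIcard : (I.card : ℝ) = ((q : ℝ) * L) ^ n := by
    rw [hI, Fintype.card_piFinset]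
    simp only [Int.card_Ico, prod_const, card_univ, Fintype.card_fin]
    rw [show (-(N : ℤ) + q * L - -(N : ℤ)).toNat = q * L by
      rw [show (-(N : ℤ) + q * L - -(N : ℤ)) = ((q * L : ℕ) : ℤ) by push_cast; ring]
      exact Int.toNat_natCast _]
    push_cast; rfl
  have hsum := sum_box_periodic hq hF (-(N : ℤ)) L
  rw [← hI] at hsum
  set T := ∑ a ∈ cube n q, F a with hT
  have hTabs : |T| ≤ (q : ℝ) ^ n := by
    refine (abs_sum_le_sum_abs _ _).trans ((sum_le_sum fun a _ => hF1 a).trans ?_)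
    rw [sum_const, card_cube]; simp
  have hq' : (0 : ℝ) < (q : ℝ) := by exact_mod_cast hq
  set x : ℝ := (q * L : ℝ) / B with hx
  have hx1 : x ≤ 1 := by
    rw [hx, div_le_one hBpos, hB]; exact_mod_cast hqL
  have hx0 : 0 ≤ x := by positivity
  have hxl : 1 - x ≤ q / B := by
    rw [hx, sub_le_iff_le_add, ← add_div, le_div_iff₀ hBpos, one_mul]
    have : ((2 * N + 1 : ℕ) : ℝ) ≤ ((q * L + q : ℕ) : ℝ) := by exact_mod_cast hqL'.le
    push_cast at this
    rw [hB]; linarith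
  have hbern : 1 - x ^ n ≤ n * (q / B) := by
    have := one_add_mul_le_pow (a := x - 1) (by linarith) n
    have e : 1 + (x - 1) = x := by ring
    rw [e] at this
    have hn0 : (0 : ℝ) ≤ n := by positivity
    nlinarith
  have hxn : 0 ≤ 1 - x ^ n := sub_nonneg.2 (pow_le_one₀ hx0 hx1)
  have hrest : |∑ a ∈ coeffBox n N, F a - (L : ℝ) ^ n * T| ≤ B ^ n * (1 - x ^ n) := by
    rw [← hsum, ← sum_sdiff hsub, add_sub_cancel_right]
    refine (abs_sum_le_sum_abs _ _).trans ((sum_le_sum fun a _ => hF1 a).trans ?_)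
    rw [sum_const, nsmul_eq_mul, mul_one, cast_card_sdiff hsub, card_coeffBox, hIcard, hx,
      div_pow]
    apply le_of_eq
    rw [← hB]
    field_simp
  have hmain : |boxAvg n N F - T / (q : ℝ) ^ n| ≤ 2 * (1 - x ^ n) := by
    have e : boxAvg n N F - T / (q : ℝ) ^ n =
        (∑ a ∈ coeffBox n N, F a - (L : ℝ) ^ n * T) / B ^ n -
          T / (q : ℝ) ^ n * (1 - x ^ n) := by
      rw [boxAvg, hx, div_pow, mul_pow, ← hB]
      field_simp
      ring
    rw [e]
    refine (abs_sub _ _).trans ?_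
    have e1 : |(∑ a ∈ coeffBox n N, F a - (L : ℝ) ^ n * T) / B ^ n| ≤ 1 - x ^ n := by
      rw [abs_div, abs_of_pos (pow_pos hBpos n), div_le_iff₀ (pow_pos hBpos n)]
      linarith
    have e2 : |T / (q : ℝ) ^ n * (1 - x ^ n)| ≤ 1 - x ^ n := by
      rw [abs_mul, abs_of_nonneg hxn, abs_div, abs_of_pos (pow_pos hq' n)]
      exact mul_le_of_le_one_left hxn ((div_le_one (pow_pos hq' n)).2 hTabs)
    linarith
  refine hmain.trans ?_
  have hN' : (0 : ℝ) < N := by exact_mod_cast hN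
  calc 2 * (1 - x ^ n) ≤ 2 * (n * (q / B)) := by linarith
    _ ≤ 2 * (n * (q / (2 * N))) := by gcongr; rw [hB]; linarith
    _ = n * q / N := by field_simp

lemma box_moment_near {n N : ℕ} (hN : 0 < N) (S : Finset ℕ) (hS : ∀ p ∈ S, p.Prime) {z : ℝ}
    (hz : ∀ p ∈ S, (p : ℝ) ≤ z) (hz1 : 1 ≤ z) {Y : ℕ → (Fin n → ℤ) → ℝ}
    (hY : ∀ p ∈ S, PeriodicMod n p (Y p)) (hY1 : ∀ p ∈ S, ∀ a, |Y p a| ≤ 1) (k : ℕ) :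
    |boxAvg n N (fun a => (∑ p ∈ S, Y p a) ^ k) -
      (Nat.factorial k : ℝ) * PowerSeries.coeff k (∏ p ∈ S, cubeSeries n p (Y p))| ≤
      (S.card : ℝ) ^ k * (n * z ^ k / N) := by
  rw [← cube_moment_eq S hS hY]
  set Q := ∏ p ∈ S, p with hQ
  have hQpos : 0 < Q := prod_pos fun p hp => (hS p hp).pos
  set 𝒯 : Finset (Fin k → ℕ) := Fintype.piFinset fun _ => S with h𝒯
  have hexp : ∀ a, (∑ p ∈ S, Y p a) ^ k = ∑ t ∈ 𝒯, ∏ j, Y (t j) a := by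
    intro a
    rw [← prod_univ_sum (fun _ : Fin k => S) (fun _ p => Y p a)]
    simp
  have hterm : ∀ t ∈ 𝒯, |boxAvg n N (fun a => ∏ j, Y (t j) a) -
      (∑ a ∈ cube n Q, ∏ j, Y (t j) a) / (Q : ℝ) ^ n| ≤ n * z ^ k / N := by
    intro t ht
    have htS : ∀ j, t j ∈ S := fun j => Fintype.mem_piFinset.1 ht j
    set q := ∏ p ∈ univ.image t, p with hq
    have hqQ : q ∣ Q := prod_dvd_prod_of_subset _ _ _ fun p hp => by
      obtain ⟨j, _, rfl⟩ := mem_image.1 hp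
      exact htS j
    have hqpos : 0 < q := Nat.pos_of_dvd_of_pos hqQ hQpos
    have hper : PeriodicMod n q fun a => ∏ j, Y (t j) a :=
      PeriodicMod.prod univ (q := t) (F := fun j a => Y (t j) a) (fun j _ => hY _ (htS j))
        fun j _ => dvd_prod_of_mem _ (mem_image_of_mem _ (mem_univ j))
    have hbd : ∀ a, |∏ j, Y (t j) a| ≤ 1 := by
      intro a
      rw [abs_prod]
      exact prod_le_one (fun _ _ => abs_nonneg _) fun j _ => hY1 _ (htS j) a
    have e : (∑ a ∈ cube n Q, ∏ j, Y (t j) a) / (Q : ℝ) ^ n =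
        (∑ a ∈ cube n q, ∏ j, Y (t j) a) / (q : ℝ) ^ n := by
      rw [sum_cube_periodic hqpos hper hqQ]
      have hq' : (q : ℝ) ≠ 0 := by exact_mod_cast hqpos.ne'
      have hQ' : (Q : ℝ) ≠ 0 := by exact_mod_cast hQpos.ne'
      rw [Nat.cast_div hqQ hq', div_pow]
      field_simp
    rw [e]
    refine (boxAvg_periodic hN hqpos hper hbd).trans ?_
    gcongr
    rw [hq, Nat.cast_prod]
    calc ∏ p ∈ univ.image t, (p : ℝ) ≤ ∏ p ∈ univ.image t, z := by
          refine prod_le_prod (fun _ _ => by positivity) fun p hp => ?_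
          obtain ⟨j, _, rfl⟩ := mem_image.1 hp
          exact hz _ (htS j)
      _ = z ^ (univ.image t).card := by simp
      _ ≤ z ^ k := pow_le_pow_right₀ hz1 (card_image_le.trans (by simp))
  have e1 : boxAvg n N (fun a => (∑ p ∈ S, Y p a) ^ k) =
      ∑ t ∈ 𝒯, boxAvg n N (fun a => ∏ j, Y (t j) a) := by
    simp only [boxAvg, hexp]
    rw [sum_comm, sum_div]
  have e2 : (∑ a ∈ cube n Q, (∑ p ∈ S, Y p a) ^ k) / (Q : ℝ) ^ n =
      ∑ t ∈ 𝒯, (∑ a ∈ cube n Q, ∏ j, Y (t j) a) / (Q : ℝ) ^ n := by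
    simp only [hexp]
    rw [sum_comm, sum_div]
  rw [e1, e2, ← sum_sub_distrib]
  refine (abs_sum_le_sum_abs _ _).trans ((sum_le_sum hterm).trans ?_)
  rw [sum_const, nsmul_eq_mul, h𝒯, Fintype.card_piFinset]
  simp

lemma coeff_intPoly (n : ℕ) (a : Fin n → ℤ) (m : ℕ) :
    (intPoly n a).coeff m = if h : m < n then a ⟨m, h⟩ else if m = n then 1 else 0 := by
  rw [intPoly, coeff_add, coeff_X_pow, finsetSum_coeff]
  simp only [coeff_C_mul, coeff_X_pow, mul_ite, mul_one, mul_zero]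
  by_cases h : m < n
  · rw [dif_pos h, if_neg h.ne, zero_add, sum_eq_single ⟨m, h⟩]
    · simp
    · intro b _ hb
      rw [if_neg]
      rintro rfl
      exact hb rfl
    · simp
  · rw [dif_neg h, sum_eq_zero, add_zero]
    intro i _
    rw [if_neg]
    have := i.2
    omega

lemma intPoly_monic (n : ℕ) (a : Fin n → ℤ) : (intPoly n a).Monic ∧ (intPoly n a).natDegree = n := by
  have h1 : (intPoly n a).natDegree ≤ n := by
    rw [natDegree_le_iff_coeff_eq_zero]
    intro m hm
    rw [coeff_intPoly, dif_neg (by omega), if_neg (by omega)]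
  have h2 : (intPoly n a).coeff n = 1 := by
    rw [coeff_intPoly, dif_neg (by omega), if_pos rfl]
  refine ⟨monic_of_natDegree_le_of_coeff_eq_one n h1 h2, le_antisymm h1 ?_⟩
  exact le_natDegree_of_ne_zero (by rw [h2]; exact one_ne_zero)

lemma hasSplitType_periodic (n : ℕ) (r : Fin n → ℕ) (p : ℕ) :
    PeriodicMod n p fun a => HasSplitType n r a p := by
  intro a b hab
  have : (intPoly n a).map (Int.castRingHom (ZMod p)) =
      (intPoly n b).map (Int.castRingHom (ZMod p)) := by
    ext m
    rw [coeff_map, coeff_map, coeff_intPoly, coeff_intPoly]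
    split_ifs with h
    · exact (ZMod.intCast_eq_intCast_iff _ _ p).2 (hab _)
    all_goals rfl
  simp only [HasSplitType, this]

lemma card_filter_hasSplitType (n : ℕ) (r : Fin n → ℕ) {p : ℕ} (hp : p.Prime) :
    ((cube n p).filter fun a => HasSplitType n r a p).card = Xcard n r p := by
  have hp0 : (0 : ℤ) < p := by exact_mod_cast hp.pos
  have : Fact p.Prime := ⟨hp⟩
  set φ : (Fin n → ℤ) → (ZMod p)[X] := fun a => (intPoly n a).map (Int.castRingHom (ZMod p))
    with hφ
  have hinj : Set.InjOn φ ((cube n p).filter fun a => HasSplitType n r a p) := by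
    intro a ha b hb hab
    have ha' := mem_cube.1 (mem_filter.1 ha).1
    have hb' := mem_cube.1 (mem_filter.1 hb).1
    funext i
    have h := congrArg (fun g : (ZMod p)[X] => g.coeff i) hab
    simp only [hφ, coeff_map, coeff_intPoly, dif_pos i.2] at h
    have h2 : a i ≡ b i [ZMOD p] := (ZMod.intCast_eq_intCast_iff _ _ p).1 h
    rwa [Int.ModEq, Int.emod_eq_of_lt (ha' i).1 (ha' i).2,
      Int.emod_eq_of_lt (hb' i).1 (hb' i).2] at h2
  rw [← card_image_of_injOn hinj, ← Set.ncard_coe_finset, Xcard]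
  change _ = Set.ncard {g : (ZMod p)[X] | g.Monic ∧ g.natDegree = n ∧ SplitTypeOf g r}
  congr 1
  ext g
  simp only [coe_image, Set.mem_image, mem_coe, mem_filter]
  constructor
  · rintro ⟨a, ⟨_, h⟩, rfl⟩
    obtain ⟨h1, h2⟩ := intPoly_monic n a
    exact ⟨h1.map _, by rw [hφ, h1.natDegree_map, h2], h⟩
  · rintro ⟨h1, h2, h3⟩
    have hφg : φ (fun i => ((g.coeff i).val : ℤ)) = g := by
      ext m
      simp only [hφ, coeff_map, coeff_intPoly]
      split_ifs with h h'
      · simp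
      · subst h'
        simp only [map_one]
        rw [← h2, h1.coeff_natDegree]
      · rw [coeff_eq_zero_of_natDegree_lt (by omega), map_zero]
    refine ⟨fun i => ((g.coeff i).val : ℤ), ⟨?_, ?_⟩, hφg⟩
    · rw [mem_cube]
      exact fun i => ⟨by positivity, by exact_mod_cast ZMod.val_lt _⟩
    · change SplitTypeOf (φ _) r
      rw [hφg]; exact h3

/-- The density of the splitting type `r` among monic polynomials modulo `p`. -/
def locDelta (n : ℕ) (r : Fin n → ℕ) (p : ℕ) : ℝ := (Xcard n r p : ℝ) / (p : ℝ) ^ n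

lemma locDelta_nonneg (n : ℕ) (r : Fin n → ℕ) (p : ℕ) : 0 ≤ locDelta n r p := by
  unfold locDelta; positivity

lemma locDelta_le_one (n : ℕ) (r : Fin n → ℕ) {p : ℕ} (hp : p.Prime) : locDelta n r p ≤ 1 := by
  have hp0 : (0 : ℝ) < p := by exact_mod_cast hp.pos
  rw [locDelta, div_le_one (by positivity), ← card_filter_hasSplitType n r hp]
  calc (((cube n p).filter fun a => HasSplitType n r a p).card : ℝ) ≤ ((cube n p).card : ℝ) := by
        exact_mod_cast card_filter_le _ _
    _ = (p : ℝ) ^ n := by rw [card_cube]; push_cast; rfl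

lemma Yp_eq (n : ℕ) (r : Fin n → ℕ) (p : ℕ) (a : Fin n → ℤ) :
    Yp n r p a = (if HasSplitType n r a p then (1 : ℝ) else 0) - locDelta n r p := rfl

lemma Yp_periodic (n : ℕ) (r : Fin n → ℕ) (p : ℕ) : PeriodicMod n p (Yp n r p) := by
  intro a b hab
  have := hasSplitType_periodic n r p a b hab
  simp only [Yp, this]

lemma abs_Yp_le_one (n : ℕ) (r : Fin n → ℕ) {p : ℕ} (hp : p.Prime) (a : Fin n → ℤ) :
    |Yp n r p a| ≤ 1 := by
  have h0 := locDelta_nonneg n r p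
  have h1 := locDelta_le_one n r hp
  rw [Yp_eq, abs_le]
  split_ifs <;> constructor <;> linarith

lemma sum_cube_Yp_pow (n : ℕ) (r : Fin n → ℕ) {p : ℕ} (hp : p.Prime) (m : ℕ) :
    (∑ a ∈ cube n p, Yp n r p a ^ m) / (p : ℝ) ^ n =
      locDelta n r p * (1 - locDelta n r p) ^ m +
        (1 - locDelta n r p) * (-locDelta n r p) ^ m := by
  set d := locDelta n r p with hd
  have hp0 : (0 : ℝ) < (p : ℝ) ^ n := by have := hp.pos; positivity
  have h1 : ∀ a, Yp n r p a ^ m = (-d) ^ m +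
      (if HasSplitType n r a p then (1 - d) ^ m - (-d) ^ m else 0) := by
    intro a
    rw [Yp_eq, ← hd]
    split_ifs <;> simp
  simp only [h1]
  rw [sum_add_distrib, sum_const, ← sum_filter, sum_const, card_filter_hasSplitType n r hp,
    card_cube]
  have hX : (Xcard n r p : ℝ) = d * (p : ℝ) ^ n := by
    rw [hd, locDelta]; field_simp
  simp only [nsmul_eq_mul]
  rw [hX]
  push_cast
  field_simp
  ring

/-- The variance of the indicator of splitting type `r` modulo `p`. -/
def locVar (n : ℕ) (r : Fin n → ℕ) (p : ℕ) : ℝ := locDelta n r p - locDelta n r p ^ 2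

lemma locVar_nonneg (n : ℕ) (r : Fin n → ℕ) {p : ℕ} (hp : p.Prime) : 0 ≤ locVar n r p := by
  have h0 := locDelta_nonneg n r p
  have h1 := locDelta_le_one n r hp
  unfold locVar; nlinarith

lemma locVar_le_one (n : ℕ) (r : Fin n → ℕ) (p : ℕ) : locVar n r p ≤ 1 := by
  unfold locVar; nlinarith [sq_nonneg (locDelta n r p - 1)]

lemma isMomentSeries_Yp (n : ℕ) (r : Fin n → ℕ) {p : ℕ} (hp : p.Prime) :
    IsMomentSeries (locVar n r p) (cubeSeries n p (Yp n r p)) := by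
  have h0 := locDelta_nonneg n r p
  have h1 := locDelta_le_one n r hp
  constructor
  · rw [coeff_cubeSeries, sum_cube_Yp_pow n r hp]; simp
  · rw [coeff_cubeSeries, sum_cube_Yp_pow n r hp]; simp; ring
  · rw [coeff_cubeSeries, sum_cube_Yp_pow n r hp, locVar]; simp; ring
  · intro m hm
    rw [coeff_cubeSeries, sum_cube_Yp_pow n r hp]
    set d := locDelta n r p with hd
    have hf : (2 : ℝ) ≤ (Nat.factorial m : ℝ) := by
      have : 2 ≤ Nat.factorial m := le_trans (by omega) (Nat.self_le_factorial m)
      exact_mod_cast this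
    have e1 : |d * (1 - d) ^ m + (1 - d) * (-d) ^ m| ≤ locVar n r p := by
      refine (abs_add_le _ _).trans ?_
      rw [abs_mul, abs_mul, abs_pow, abs_pow, abs_neg, abs_of_nonneg h0,
        abs_of_nonneg (by linarith : 0 ≤ 1 - d)]
      have e2 : (1 - d) ^ m ≤ (1 - d) ^ 2 :=
        pow_le_pow_of_le_one (by linarith) (by linarith) (by omega)
      have e3 : d ^ m ≤ d ^ 2 := pow_le_pow_of_le_one h0 h1 (by omega)
      calc d * (1 - d) ^ m + (1 - d) * d ^ m ≤ d * (1 - d) ^ 2 + (1 - d) * d ^ 2 := by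
            have : 0 ≤ 1 - d := by linarith
            gcongr
        _ = locVar n r p := by rw [locVar, ← hd]; ring
    rw [abs_div, abs_of_pos (by linarith : (0 : ℝ) < (Nat.factorial m : ℝ))]
    have := locVar_nonneg n r hp
    gcongr

/-- The primes up to `z`. -/
def primesTo (z : ℝ) : Finset ℕ := (range (⌊z⌋₊ + 1)).filter Nat.Prime

lemma prime_of_mem_primesTo {z : ℝ} {p : ℕ} (hp : p ∈ primesTo z) : p.Prime :=
  (mem_filter.1 hp).2

lemma le_of_mem_primesTo {z : ℝ} (hz : 0 ≤ z) {p : ℕ} (hp : p ∈ primesTo z) : (p : ℝ) ≤ z := by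
  have := mem_range.1 (mem_filter.1 hp).1
  exact (Nat.le_floor_iff hz).1 (by omega)

/-- The total variance of the splitting type `r` over the primes up to `z`. -/
def totalVar (n : ℕ) (r : Fin n → ℕ) (z : ℝ) : ℝ := ∑ p ∈ primesTo z, locVar n r p

lemma box_second_moment {n N : ℕ} (hN : 0 < N) (r : Fin n → ℕ) {z : ℝ} (hz : 1 ≤ z) :
    |boxAvg n N (fun a => (∑ p ∈ primesTo z, Yp n r p a) ^ 2) - totalVar n r z| ≤
      (primePi z : ℝ) ^ 2 * (n * z ^ 2 / N) := by
  have h := box_moment_near hN (primesTo z) (fun p hp => prime_of_mem_primesTo hp)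
    (fun p hp => le_of_mem_primesTo (by linarith) hp) hz (Y := Yp n r)
    (fun p _ => Yp_periodic n r p) (fun p hp => abs_Yp_le_one n r (prime_of_mem_primesTo hp)) 2
  rw [(coeff_two_prod (primesTo z) fun p hp =>
    isMomentSeries_Yp n r (prime_of_mem_primesTo hp)).2.2] at h
  have e : ((Nat.factorial 2 : ℕ) : ℝ) * ((∑ p ∈ primesTo z, locVar n r p) / 2) =
      totalVar n r z := by
    rw [totalVar, Nat.factorial_two]; push_cast; ring
  rw [e] at h
  exact h

lemma box_even_moment {n N : ℕ} (hN : 0 < N) (r : Fin n → ℕ) {z : ℝ} (hz : 1 ≤ z)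
    (hV : 8 ≤ totalVar n r z) {j : ℕ} (hj : 1 ≤ j)
    (hjV : ((2 * j : ℕ) : ℝ) ^ 3 ≤ totalVar n r z) :
    |boxAvg n N (fun a => (∑ p ∈ primesTo z, Yp n r p a) ^ (2 * j)) -
      (Nat.factorial (2 * j) : ℝ) * ((totalVar n r z / 2) ^ j / (Nat.factorial j : ℝ))| ≤
      (Nat.factorial (2 * j) : ℝ) * (9 * (((2 * j : ℕ) : ℝ) ^ 3 / totalVar n r z) *
        ((totalVar n r z / 2) ^ j / (Nat.factorial j : ℝ))) +
      (primePi z : ℝ) ^ (2 * j) * (n * z ^ (2 * j) / N) := by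
  have h := box_moment_near hN (primesTo z) (fun p hp => prime_of_mem_primesTo hp)
    (fun p hp => le_of_mem_primesTo (by linarith) hp) hz (Y := Yp n r)
    (fun p _ => Yp_periodic n r p) (fun p hp => abs_Yp_le_one n r (prime_of_mem_primesTo hp))
    (2 * j)
  have h2 := coeff_prod_moment_near (primesTo z)
    (fun p hp => locVar_nonneg n r (prime_of_mem_primesTo hp)) (fun p _ => locVar_le_one n r p)
    (fun p hp => isMomentSeries_Yp n r (prime_of_mem_primesTo hp)) (V := totalVar n r z) rfl
    hV hj hjV
  refine (abs_sub_le _ _ _).trans ((add_le_add h ?_).trans (le_of_eq (add_comm _ _)))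
  rw [← mul_sub, abs_mul, Nat.abs_cast]
  gcongr

/-- The monic irreducible polynomials of degree `d` modulo `p`. -/
def irrSet (p d : ℕ) : Set (ZMod p)[X] := {h | h.Monic ∧ Irreducible h ∧ h.natDegree = d}

lemma finite_natDegree_eq (p d : ℕ) [Fact p.Prime] : {h : (ZMod p)[X] | h.natDegree ≤ d}.Finite := by
  have h : Set.InjOn (fun (h : (ZMod p)[X]) (i : Fin (d + 1)) => h.coeff i)
      {h : (ZMod p)[X] | h.natDegree ≤ d} := by
    intro f hf g hg hfg
    ext m
    by_cases hm : m < d + 1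
    · exact congrFun hfg ⟨m, hm⟩
    · simp only [Set.mem_ofPred_eq] at hf hg
      rw [coeff_eq_zero_of_natDegree_lt (by omega), coeff_eq_zero_of_natDegree_lt (by omega)]
  exact Set.Finite.of_finite_image (Set.toFinite _) h

lemma irrSet_finite (p d : ℕ) [Fact p.Prime] : (irrSet p d).Finite :=
  (finite_natDegree_eq p d).subset fun _ h => h.2.2.le

/-- The monic irreducible polynomials of degree `d` modulo `p`, as a finset. -/
def irr (p d : ℕ) [Fact p.Prime] : Finset (ZMod p)[X] := (irrSet_finite p d).toFinset

lemma mem_irr {p d : ℕ} [Fact p.Prime] {h : (ZMod p)[X]} :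
    h ∈ irr p d ↔ h.Monic ∧ Irreducible h ∧ h.natDegree = d := by
  simp [irr, irrSet]

lemma mul_card_irr_of_card {p d : ℕ} [Fact p.Prime] (hd : d ≠ 0) {K : Type*} [Field K]
    [Fintype K] [Algebra (ZMod p) K] (hcard : Fintype.card K = p ^ d)
    (hfin : Module.finrank (ZMod p) K = d) :
    d * (irr p d).card ≤ p ^ d ∧ p ^ d ≤ d * (irr p d).card + d * p ^ (d - 1) := by
  have hcardp : Nat.card (ZMod p) = p := by simp
  have hp : p.Prime := Fact.out
  have hintegral : ∀ α : K, IsIntegral (ZMod p) α := fun α => Algebra.IsIntegral.isIntegral α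
  have hfib : ∀ h ∈ irr p d, (univ.filter fun α : K => minpoly (ZMod p) α = h).card = d := by
    intro h hh
    obtain ⟨h1, h2, h3⟩ := mem_irr.1 hh
    have hdvd : h ∣ X ^ p ^ d - X := by
      have := (h2.natDegree_dvd_iff_dvd_X_pow_card_pow_sub_X (n := d)).1 (by rw [h3])
      rwa [hcardp] at this
    have hsp : (h.map (algebraMap (ZMod p) K)).Splits := by
      have hK := (FiniteField.isSplittingField_sub K (ZMod p)).splits
      rw [hcard] at hK
      refine Splits.of_dvd hK ?_
        (map_dvd (algebraMap _ K) hdvd)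
      exact Polynomial.map_ne_zero (FiniteField.X_pow_card_pow_sub_X_ne_zero _ hd hp.one_lt)
    have hsep : h.Separable := PerfectField.separable_of_irreducible h2
    have hc := card_rootSet_eq_natDegree hsep hsp
    rw [h3] at hc
    rw [← hc, ← Set.toFinset_card]
    congr 1
    ext α
    simp only [mem_filter, mem_univ, true_and, Set.mem_toFinset, mem_rootSet]
    constructor
    · rintro rfl
      exact ⟨minpoly.ne_zero (hintegral α), minpoly.aeval _ _⟩
    · rintro ⟨_, h5⟩
      exact (minpoly.eq_of_irreducible_of_monic h2 h5 h1).symm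
  have hmaps : ∀ α ∈ univ.filter (fun α : K => (minpoly (ZMod p) α).natDegree = d),
      minpoly (ZMod p) α ∈ irr p d := fun α hα =>
    mem_irr.2 ⟨minpoly.monic (hintegral α), minpoly.irreducible (hintegral α), (mem_filter.1 hα).2⟩
  have hcount : (univ.filter (fun α : K => (minpoly (ZMod p) α).natDegree = d)).card =
      d * (irr p d).card := by
    rw [card_eq_sum_card_fiberwise hmaps, sum_congr rfl (g := fun _ => d), sum_const,
      smul_eq_mul, mul_comm]
    intro h hh
    refine Eq.trans ?_ (hfib h hh)
    congr 1
    ext α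
    simp only [mem_filter, mem_univ, true_and, and_iff_right_iff_imp]
    rintro rfl
    exact (mem_irr.1 hh).2.2
  have hbad : ∀ e ∈ Ico 1 d,
      (univ.filter (fun α : K => (minpoly (ZMod p) α).natDegree = e)).card ≤ p ^ (d - 1) := by
    intro e he
    rw [mem_Ico] at he
    have hne : (X ^ p ^ e - X : K[X]) ≠ 0 :=
      FiniteField.X_pow_card_pow_sub_X_ne_zero _ (by omega) hp.one_lt
    calc (univ.filter (fun α : K => (minpoly (ZMod p) α).natDegree = e)).card
        ≤ ((X ^ p ^ e - X : K[X]).roots.toFinset).card := by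
          refine card_le_card fun α hα => ?_
          have hα' := (mem_filter.1 hα).2
          have hdvd := ((minpoly.irreducible (hintegral α)).natDegree_dvd_iff_dvd_X_pow_card_pow_sub_X
            (n := e)).1 (by rw [hα'])
          rw [hcardp] at hdvd
          rw [Multiset.mem_toFinset, mem_roots hne]
          obtain ⟨q, hq⟩ := hdvd
          have := congrArg (aeval α) hq
          simp only [map_sub, map_pow, aeval_X, map_mul, minpoly.aeval, zero_mul] at this
          simpa [IsRoot] using this
      _ ≤ (X ^ p ^ e - X : K[X]).natDegree :=
          (Multiset.toFinset_card_le _).trans (card_roots' _)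
      _ = p ^ e := FiniteField.X_pow_card_pow_sub_X_natDegree_eq _ (by omega) hp.one_lt
      _ ≤ p ^ (d - 1) := Nat.pow_le_pow_right hp.pos (by omega)
  rw [← hcount, ← hcard]
  refine ⟨card_le_univ _, ?_⟩
  have hsub : (univ : Finset K) ⊆ univ.filter (fun α : K => (minpoly (ZMod p) α).natDegree = d) ∪
      (Ico 1 d).biUnion fun e =>
        univ.filter (fun α : K => (minpoly (ZMod p) α).natDegree = e) := by
    intro α _
    have h1 := minpoly.natDegree_pos (hintegral α)
    have h2 := minpoly.natDegree_le (A := ZMod p) α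
    rw [hfin] at h2
    simp only [mem_union, mem_filter, mem_univ, true_and, mem_biUnion, mem_Ico]
    by_cases h : (minpoly (ZMod p) α).natDegree = d
    · exact Or.inl h
    · exact Or.inr ⟨_, ⟨by omega, by omega⟩, rfl⟩
  rw [← card_univ]
  refine (card_le_card hsub).trans ((card_union_le _ _).trans ?_)
  gcongr
  refine card_biUnion_le.trans ((sum_le_sum hbad).trans ?_)
  rw [sum_const, smul_eq_mul, Nat.card_Ico]
  gcongr
  omega

lemma mul_card_irr (p d : ℕ) [Fact p.Prime] (hd : d ≠ 0) :
    d * (irr p d).card ≤ p ^ d ∧ p ^ d ≤ d * (irr p d).card + d * p ^ (d - 1) := by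
  let _ : Fintype (GaloisField p d) := Fintype.ofFinite _
  refine mul_card_irr_of_card (K := GaloisField p d) hd ?_ (GaloisField.finrank p hd)
  rw [← Nat.card_eq_fintype_card]
  exact GaloisField.card p d hd

lemma dvd_of_mem_irr_eq {p : ℕ} [Fact p.Prime] {d e : ℕ} {h h' : (ZMod p)[X]}
    (hh : h ∈ irr p d) (hh' : h' ∈ irr p e) (hd : h ∣ h') : h = h' := by
  obtain ⟨h1, h2, _⟩ := mem_irr.1 hh
  obtain ⟨h1', h2', _⟩ := mem_irr.1 hh'
  exact eq_of_monic_of_associated h1 h1' (h2.associated_of_dvd h2' hd)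

lemma isCoprime_of_mem_irr {p : ℕ} [Fact p.Prime] {d e : ℕ} {h h' : (ZMod p)[X]}
    (hh : h ∈ irr p d) (hh' : h' ∈ irr p e) (hne : h ≠ h') : IsCoprime h h' := by
  obtain ⟨h1, h2, _⟩ := mem_irr.1 hh
  rw [h2.coprime_iff_not_dvd]
  exact fun hd => hne (dvd_of_mem_irr_eq hh hh' hd)

/-- The polynomial with prescribed monic irreducible factors of each degree. -/
def factorProd {p n : ℕ} (s : Fin n → Finset (ZMod p)[X]) : (ZMod p)[X] := ∏ i, ∏ h ∈ s i, h

lemma factorProd_eq_sigma {p n : ℕ} (s : Fin n → Finset (ZMod p)[X]) :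
    factorProd s = ∏ x ∈ univ.sigma s, x.2 := by
  rw [factorProd, prod_sigma']

lemma pairwise_coprime_sigma {p n : ℕ} [Fact p.Prime] {s : Fin n → Finset (ZMod p)[X]}
    (hs : ∀ i, s i ⊆ irr p ((i : ℕ) + 1)) :
    Set.Pairwise (↑(univ.sigma s) : Set (Σ _ : Fin n, (ZMod p)[X]))
      (Function.onFun IsCoprime fun x => x.2) := by
  rintro ⟨i, h⟩ hx ⟨j, h'⟩ hy hne
  simp only [coe_sigma, Set.mem_sigma_iff, mem_coe] at hx hy
  refine isCoprime_of_mem_irr (hs i hx.2) (hs j hy.2) ?_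
  rintro rfl
  apply hne
  simp only at hx hy
  have e1 := (mem_irr.1 (hs i hx.2)).2.2
  have e2 := (mem_irr.1 (hs j hy.2)).2.2
  obtain rfl : i = j := Fin.ext (by omega)
  rfl

lemma factorProd_monic {p n : ℕ} [Fact p.Prime] {s : Fin n → Finset (ZMod p)[X]}
    (hs : ∀ i, s i ⊆ irr p ((i : ℕ) + 1)) : (factorProd s).Monic :=
  monic_prod_of_monic _ _ fun i _ => monic_prod_of_monic _ _ fun _ hh => (mem_irr.1 (hs i hh)).1

lemma natDegree_factorProd {p n : ℕ} [Fact p.Prime] {s : Fin n → Finset (ZMod p)[X]}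
    (hs : ∀ i, s i ⊆ irr p ((i : ℕ) + 1)) :
    (factorProd s).natDegree = ∑ i : Fin n, ((i : ℕ) + 1) * (s i).card := by
  rw [factorProd, natDegree_prod_of_monic _ _ fun i _ => monic_prod_of_monic _ _ fun _ hh =>
    (mem_irr.1 (hs i hh)).1]
  refine sum_congr rfl fun i _ => ?_
  rw [natDegree_prod_of_monic _ _ fun _ hh => (mem_irr.1 (hs i hh)).1,
    sum_congr rfl fun _ hh => (mem_irr.1 (hs i hh)).2.2, sum_const, smul_eq_mul, mul_comm]

lemma dvd_factorProd_iff {p n : ℕ} [Fact p.Prime] {s : Fin n → Finset (ZMod p)[X]}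
    (hs : ∀ i, s i ⊆ irr p ((i : ℕ) + 1)) {i : Fin n} {h : (ZMod p)[X]}
    (hh : h ∈ irr p ((i : ℕ) + 1)) : h ∣ factorProd s ↔ h ∈ s i := by
  constructor
  · intro hd
    rw [factorProd_eq_sigma] at hd
    obtain ⟨⟨j, h'⟩, hx, hd'⟩ := (mem_irr.1 hh).2.1.prime.exists_mem_finset_dvd hd
    have hx' := (mem_sigma.1 hx).2
    simp only at hx' hd'
    obtain rfl := dvd_of_mem_irr_eq hh (hs j hx') hd'
    have e1 := (mem_irr.1 hh).2.2
    have e2 := (mem_irr.1 (hs j hx')).2.2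
    obtain rfl : i = j := Fin.ext (by omega)
    exact hx'
  · intro hm
    rw [factorProd_eq_sigma]
    exact dvd_prod_of_mem (fun x : (Σ _ : Fin n, (ZMod p)[X]) => x.2)
      (mem_sigma.2 ⟨mem_univ i, hm⟩ : (⟨i, h⟩ : Σ _ : Fin n, (ZMod p)[X]) ∈ univ.sigma s)

lemma splitTypeOf_iff {p n : ℕ} [Fact p.Prime] {r : Fin n → ℕ} {g : (ZMod p)[X]} :
    SplitTypeOf g r ↔ Squarefree g ∧
      ∀ i : Fin n, ((irr p ((i : ℕ) + 1)).filter fun h => h ∣ g).card = r i := by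
  have : ∀ i : Fin n, Nat.card {h : Polynomial (ZMod p) // h.Monic ∧ Irreducible h ∧
      h.natDegree = (i : ℕ) + 1 ∧ h ∣ g} =
      ((irr p ((i : ℕ) + 1)).filter fun h => h ∣ g).card := by
    intro i
    rw [← Set.ncard_coe_finset]
    change Set.ncard {h : Polynomial (ZMod p) | h.Monic ∧ Irreducible h ∧
      h.natDegree = (i : ℕ) + 1 ∧ h ∣ g} = _
    congr 1
    ext h
    simp [mem_irr, and_assoc]
  simp only [SplitTypeOf, this]

lemma factorProd_filter {p n : ℕ} [Fact p.Prime] {r : Fin n → ℕ}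
    (hr : ∑ i : Fin n, ((i : ℕ) + 1) * r i = n) {g : (ZMod p)[X]} (hg : g.Monic)
    (hgn : g.natDegree = n) (ht : SplitTypeOf g r) :
    factorProd (fun i : Fin n => (irr p ((i : ℕ) + 1)).filter fun h => h ∣ g) = g := by
  obtain ⟨_, hc⟩ := splitTypeOf_iff.1 ht
  have hs : ∀ i : Fin n, ((irr p ((i : ℕ) + 1)).filter fun h => h ∣ g) ⊆
    irr p ((i : ℕ) + 1) := fun i => filter_subset _ _
  symm
  refine eq_of_monic_of_dvd_of_natDegree_le (factorProd_monic hs) hg ?_ ?_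
  · rw [factorProd_eq_sigma]
    exact prod_dvd_of_coprime (pairwise_coprime_sigma hs) fun x hx =>
      (mem_filter.1 (mem_sigma.1 hx).2).2
  · rw [natDegree_factorProd hs, hgn, sum_congr rfl fun i _ => by rw [hc i], hr]

lemma Xcard_eq_prod_choose {n p : ℕ} [Fact p.Prime] {r : Fin n → ℕ}
    (hr : ∑ i : Fin n, ((i : ℕ) + 1) * r i = n) :
    Xcard n r p = ∏ i : Fin n, ((irr p ((i : ℕ) + 1)).card).choose (r i) := by
  set 𝒯 : Finset (Fin n → Finset (ZMod p)[X]) :=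
    Fintype.piFinset fun i : Fin n => powersetCard (r i) (irr p ((i : ℕ) + 1)) with h𝒯
  have hmem : ∀ s ∈ 𝒯, (∀ i, s i ⊆ irr p ((i : ℕ) + 1)) ∧ ∀ i, (s i).card = r i := by
    intro s hs
    have := fun i => mem_powersetCard.1 (Fintype.mem_piFinset.1 hs i)
    exact ⟨fun i => (this i).1, fun i => (this i).2⟩
  have hrec : ∀ s : Fin n → Finset (ZMod p)[X], (∀ i, s i ⊆ irr p ((i : ℕ) + 1)) → ∀ i : Fin n,
      (irr p ((i : ℕ) + 1)).filter (fun h => h ∣ factorProd s) = s i := by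
    intro s hs i
    ext h
    rw [mem_filter]
    exact ⟨fun hh => (dvd_factorProd_iff hs hh.1).1 hh.2,
      fun hh => ⟨hs i hh, (dvd_factorProd_iff hs (hs i hh)).2 hh⟩⟩
  have hinj : Set.InjOn factorProd (𝒯 : Set (Fin n → Finset (ZMod p)[X])) := by
    intro s hs t ht hst
    funext i
    rw [← hrec s (hmem s hs).1 i, ← hrec t (hmem t ht).1 i, hst]
  have hcard : 𝒯.card = ∏ i : Fin n, ((irr p ((i : ℕ) + 1)).card).choose (r i) := by
    rw [h𝒯, Fintype.card_piFinset]
    simp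
  rw [← hcard, ← card_image_of_injOn hinj, ← Set.ncard_coe_finset, Xcard]
  change Set.ncard {g : (ZMod p)[X] | g.Monic ∧ g.natDegree = n ∧ SplitTypeOf g r} = _
  congr 1
  ext g
  simp only [Set.mem_ofPred_eq, coe_image, Set.mem_image, mem_coe]
  constructor
  · rintro ⟨h1, h2, h3⟩
    refine ⟨_, ?_, factorProd_filter hr h1 h2 h3⟩
    rw [h𝒯, Fintype.mem_piFinset]
    exact fun i => mem_powersetCard.2 ⟨filter_subset _ _, (splitTypeOf_iff.1 h3).2 i⟩
  · rintro ⟨s, hs, rfl⟩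
    obtain ⟨h1, h2⟩ := hmem s hs
    refine ⟨factorProd_monic h1, ?_, splitTypeOf_iff.2 ⟨?_, fun i => ?_⟩⟩
    · rw [natDegree_factorProd h1, sum_congr rfl fun i _ => by rw [h2 i], hr]
    · rw [factorProd_eq_sigma]
      refine squarefree_prod_of_pairwise_isCoprime ?_ fun x hx => ?_
      · exact fun x hx y hy hxy => (pairwise_coprime_sigma h1 hx hy hxy).isRelPrime
      · exact (mem_irr.1 (h1 x.1 (mem_sigma.1 hx).2)).2.1.squarefree
    · rw [hrec s h1 i, h2 i]

/-- `f p = a + O(1 / p)` over the primes. -/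
def NearAtPrimes (f : ℕ → ℝ) (a : ℝ) : Prop :=
  ∃ C : ℝ, 0 ≤ C ∧ ∀ p : ℕ, p.Prime → |f p - a| ≤ C / p

lemma NearAtPrimes.mul {f g : ℕ → ℝ} {a b : ℝ} (hf : NearAtPrimes f a) (hg : NearAtPrimes g b) :
    NearAtPrimes (fun p => f p * g p) (a * b) := by
  obtain ⟨C, hC, hf⟩ := hf
  obtain ⟨D, hD, hg⟩ := hg
  refine ⟨C * D + |a| * D + C * |b|, by positivity, fun p hp => ?_⟩
  have hp1 : (1 : ℝ) ≤ p := by exact_mod_cast hp.one_lt.le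
  have h1 := hf p hp
  have h2 := hg p hp
  have e : f p * g p - a * b = (f p - a) * (g p - b) + a * (g p - b) + (f p - a) * b := by ring
  have hDp : D / p ≤ D := div_le_self hD hp1
  calc |f p * g p - a * b| ≤ |f p - a| * |g p - b| + |a| * |g p - b| + |f p - a| * |b| := by
        rw [e, ← abs_mul, ← abs_mul, ← abs_mul]; exact abs_add_three _ _ _
    _ ≤ C / p * D + |a| * (D / p) + C / p * |b| := by
        gcongr
        exact h2.trans hDp
    _ = _ := by ring

lemma NearAtPrimes.const (a : ℝ) : NearAtPrimes (fun _ => a) a :=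
  ⟨0, le_rfl, fun p _ => by simp⟩

lemma NearAtPrimes.prod {ι : Type*} (s : Finset ι) {f : ι → ℕ → ℝ} {a : ι → ℝ}
    (h : ∀ i ∈ s, NearAtPrimes (f i) (a i)) :
    NearAtPrimes (fun p => ∏ i ∈ s, f i p) (∏ i ∈ s, a i) := by
  induction s using Finset.induction_on with
  | empty => simpa using NearAtPrimes.const 1
  | insert i s hi ih =>
    simp only [prod_insert hi]
    exact (h i (mem_insert_self i s)).mul (ih fun j hj => h j (mem_insert_of_mem hj))

/-- The number of monic irreducible polynomials of degree `d` modulo `p`. -/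
def irrCount (d p : ℕ) : ℕ := if h : p.Prime then @card _ (@irr p d ⟨h⟩) else 0

lemma irrCount_sub_near {d : ℕ} (hd : d ≠ 0) (j : ℕ) :
    NearAtPrimes (fun p => ((irrCount d p - j : ℕ) : ℝ) / (p : ℝ) ^ d) (1 / d) := by
  refine ⟨j + 1, by positivity, fun p hp => ?_⟩
  have : Fact p.Prime := ⟨hp⟩
  have e : irrCount d p = (irr p d).card := by rw [irrCount, dif_pos hp]
  obtain ⟨h1, h2⟩ := mul_card_irr p d hd
  rw [← e] at h1 h2
  change |((irrCount d p - j : ℕ) : ℝ) / (p : ℝ) ^ d - 1 / d| ≤ (j + 1) / p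
  generalize irrCount d p = I at *
  have hp0 : (0 : ℝ) < p := by exact_mod_cast hp.pos
  have hp1 : (1 : ℝ) ≤ p := by exact_mod_cast hp.one_lt.le
  have hd0 : (0 : ℝ) < d := by exact_mod_cast Nat.pos_of_ne_zero hd
  have h1' : (d : ℝ) * I ≤ (p : ℝ) ^ d := by exact_mod_cast h1
  have h2' : (p : ℝ) ^ d ≤ (d : ℝ) * I + d * (p : ℝ) ^ (d - 1) := by exact_mod_cast h2
  have hpd : (p : ℝ) ^ d = (p : ℝ) ^ (d - 1) * p := by
    rw [← pow_succ, Nat.sub_add_cancel (Nat.pos_of_ne_zero hd)]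
  have hP : (1 : ℝ) ≤ (p : ℝ) ^ (d - 1) := one_le_pow₀ hp1
  have hj1 : ((I - j : ℕ) : ℝ) ≤ I := by exact_mod_cast Nat.sub_le I j
  have hj2 : (I : ℝ) ≤ ((I - j : ℕ) : ℝ) + j := by exact_mod_cast (by omega : I ≤ I - j + j)
  generalize ((I - j : ℕ) : ℝ) = J at *
  generalize (p : ℝ) ^ (d - 1) = P at *
  have hPd : 0 < (p : ℝ) ^ d := by positivity
  have e2 : J / (p : ℝ) ^ d - 1 / d = (d * J - (p : ℝ) ^ d) / (d * (p : ℝ) ^ d) := by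
    field_simp
  change |J / (p : ℝ) ^ d - 1 / d| ≤ (j + 1) / p
  rw [e2, abs_div, abs_of_pos (by positivity : 0 < d * (p : ℝ) ^ d),
    div_le_div_iff₀ (by positivity) hp0, hpd]
  rw [hpd] at h1' h2'
  have hj0 : (0 : ℝ) ≤ j := by positivity
  have key : |d * J - P * p| ≤ d * (j + 1) * P := by
    rw [abs_le]
    constructor
    · have e3 : (d : ℝ) * I ≤ d * (J + j) := by gcongr
      have e4 : (d : ℝ) * j ≤ d * j * P := le_mul_of_one_le_right (by positivity) hP
      nlinarith
    · have e3 : (d : ℝ) * J ≤ d * I := by gcongr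
      have : 0 ≤ (d : ℝ) * (j + 1) * P := by positivity
      linarith
  calc |d * J - P * p| * p ≤ d * (j + 1) * P * p := by gcongr
    _ = _ := by ring

lemma choose_irrCount_near {d : ℕ} (hd : d ≠ 0) (m : ℕ) :
    NearAtPrimes (fun p => (((irrCount d p).choose m : ℕ) : ℝ) / (p : ℝ) ^ (d * m))
      (1 / ((d ^ m * Nat.factorial m : ℕ) : ℝ)) := by
  have h := (NearAtPrimes.const (1 / (Nat.factorial m : ℝ))).mul
    (NearAtPrimes.prod (range m) fun j _ => irrCount_sub_near hd j)
  convert h using 1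
  · funext p
    rw [prod_div_distrib, ← Nat.cast_prod, ← Nat.descFactorial_eq_prod_range,
      Nat.descFactorial_eq_factorial_mul_choose]
    have : (Nat.factorial m : ℝ) ≠ 0 := by exact_mod_cast Nat.factorial_ne_zero m
    push_cast
    rw [prod_const, card_range, pow_mul]
    field_simp
  · push_cast
    rw [prod_const, card_range, one_div_pow]
    field_simp

lemma locDelta_near {n : ℕ} {r : Fin n → ℕ} (hr : ∑ i : Fin n, ((i : ℕ) + 1) * r i = n) :
    NearAtPrimes (locDelta n r) (splitDelta n r) := by
  obtain ⟨C, hC, h⟩ := NearAtPrimes.prod (univ : Finset (Fin n))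
    fun i _ => choose_irrCount_near (Nat.succ_ne_zero (i : ℕ)) (r i)
  refine ⟨C, hC, fun p hp => ?_⟩
  have : Fact p.Prime := ⟨hp⟩
  have := h p hp
  have e : locDelta n r p = ∏ i : Fin n, (((irrCount (i + 1) p).choose (r i) : ℕ) : ℝ) /
      (p : ℝ) ^ ((i + 1 : ℕ) * r i) := by
    rw [locDelta, Xcard_eq_prod_choose hr, prod_div_distrib, prod_pow_eq_pow_sum]
    congr 1
    · push_cast
      refine prod_congr rfl fun i _ => ?_
      rw [irrCount, dif_pos hp]
    · congr 1
      exact hr.symm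
  rw [e]
  exact this

section GaloisRoots

open NumberField

variable {K : Type} [Field K] {f : ℤ[X]}

theorem splits_ringOfIntegers (hf : f.Monic) (hs : (f.map (algebraMap ℤ K)).Splits) :
    (f.map (algebraMap ℤ (𝓞 K))).Splits := by
  have hmap : (f.map (algebraMap ℤ (𝓞 K))).map (algebraMap (𝓞 K) K) = f.map (algebraMap ℤ K) := by
    rw [Polynomial.map_map, ← IsScalarTower.algebraMap_eq]
  refine Splits.of_splits_map_of_injective (i := algebraMap (𝓞 K) K)
    RingOfIntegers.coe_injective (by rwa [hmap]) ?_
  rw [hmap]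
  intro a ha
  have hroot := (mem_roots'.mp ha).2
  have hintegral : IsIntegral ℤ a := ⟨f, hf, by rwa [IsRoot, eval_map] at hroot⟩
  exact ⟨⟨a, hintegral⟩, rfl⟩

variable [NumberField K]

theorem aeval_coe_of_mem_rootSet {x : 𝓞 K} (hx : x ∈ f.rootSet (𝓞 K)) :
    aeval (x : K) (f.map (Int.castRingHom ℚ)) = 0 := by
  have h := (mem_rootSet'.mp hx).2
  have h2 := congrArg (algebraMap (𝓞 K) K) h
  rw [map_zero, ← aeval_algebraMap_apply] at h2
  rw [← h2]
  exact aeval_map_algebraMap ℚ (x : K) f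

theorem isPretransitive_rootSet [IsGalois ℚ K] (hf : f.Monic)
    (hirr : Irreducible (f.map (Int.castRingHom ℚ))) :
    MulAction.IsPretransitive (K ≃ₐ[ℚ] K) (f.rootSet (𝓞 K)) := by
  refine ⟨fun x y => ?_⟩
  have hmin : ∀ t : f.rootSet (𝓞 K),
      minpoly ℚ ((t : 𝓞 K) : K) = f.map (Int.castRingHom ℚ) := fun t =>
    (minpoly.eq_of_irreducible_of_monic hirr (aeval_coe_of_mem_rootSet t.2) (hf.map _)).symm
  have hconj : IsConjRoot ℚ ((y : 𝓞 K) : K) ((x : 𝓞 K) : K) := by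
    rw [IsConjRoot, hmin, hmin]
  obtain ⟨g, hg⟩ := isConjRoot_iff_exists_algEquiv.mp hconj
  refine ⟨g, Subtype.ext (RingOfIntegers.coe_injective ?_)⟩
  exact hg

theorem toPermHom_rootSet_injective (hf : f.Monic)
    (hgen : Algebra.adjoin ℚ ((f.map (Int.castRingHom ℚ)).rootSet K) = ⊤) :
    Function.Injective (MulAction.toPermHom (K ≃ₐ[ℚ] K) (f.rootSet (𝓞 K))) := by
  rw [injective_iff_map_eq_one]
  intro g hg
  have hEq : Set.EqOn (g : K →ₐ[ℚ] K) (AlgHom.id ℚ K) ((f.map (Int.castRingHom ℚ)).rootSet K) := by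
    intro x hx
    have hx0 : aeval x f = 0 := by
      rw [← (mem_rootSet'.mp hx).2]
      exact (aeval_map_algebraMap ℚ x f).symm
    have hintegral : IsIntegral ℤ x := ⟨f, hf, by simpa [aeval_def] using hx0⟩
    let y : 𝓞 K := ⟨x, hintegral⟩
    have hy : y ∈ f.rootSet (𝓞 K) := by
      refine mem_rootSet'.mpr ⟨(hf.map _).ne_zero, RingOfIntegers.coe_injective ?_⟩
      rw [map_zero, ← aeval_algebraMap_apply]
      exact hx0
    have h1 := congrArg (fun σ : Equiv.Perm (f.rootSet (𝓞 K)) => (((σ ⟨y, hy⟩ : 𝓞 K)) : K)) hg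
    exact h1
  have := AlgHom.ext_of_adjoin_eq_top hgen hEq
  ext x
  exact DFunLike.congr_fun this x

theorem natCard_rootSet (hf : f.Monic) (hs : (f.map (algebraMap ℤ K)).Splits)
    (hsep : (f.map (Int.castRingHom ℚ)).Separable) :
    Nat.card (f.rootSet (𝓞 K)) = f.natDegree := by
  have hsO := splits_ringOfIntegers hf hs
  have hmapK : (f.map (algebraMap ℤ (𝓞 K))).map (algebraMap (𝓞 K) K) =
      (f.map (Int.castRingHom ℚ)).map (algebraMap ℚ K) := by
    rw [Polynomial.map_map, Polynomial.map_map]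
    congr 1
    exact RingHom.ext_int _ _
  have hnodup : (f.map (algebraMap ℤ (𝓞 K))).roots.Nodup := by
    have h1 : ((f.map (algebraMap ℤ (𝓞 K))).map (algebraMap (𝓞 K) K)).roots.Nodup := by
      rw [hmapK]
      exact nodup_roots hsep.map
    rw [hsO.roots_map_of_injective RingOfIntegers.coe_injective] at h1
    exact h1.of_map
  rw [Nat.card_coe_set_eq, rootSet_def, Set.ncard_coe_finset, aroots_def, Multiset.toFinset_card_of_nodup hnodup, ← hsO.natDegree_eq_card_roots,
    hf.natDegree_map]

end GaloisRoots

theorem isSnPoly_of_surjective {n : ℕ} (a : Fin n → ℤ)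
    (hm : (intPoly n a).Monic) (hd : (intPoly n a).natDegree = n)
    (hirr : Irreducible (ratPoly n a))
    (h : ∀ (K : Type) [Field K] [NumberField K] [IsGalois ℚ K],
      ((intPoly n a).map (algebraMap ℤ K)).Splits →
      MulAction.IsPretransitive (K ≃ₐ[ℚ] K) ((intPoly n a).rootSet (NumberField.RingOfIntegers K)) →
      Nat.card ((intPoly n a).rootSet (NumberField.RingOfIntegers K)) = n →
      Function.Surjective (MulAction.toPermHom (K ≃ₐ[ℚ] K)
        ((intPoly n a).rootSet (NumberField.RingOfIntegers K)))) :
    IsSnPoly n a := by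
  have key : ∀ (K : Type) [Field K] [NumberField K] [IsSplittingField ℚ K (ratPoly n a)],
      Nonempty ((K ≃ₐ[ℚ] K) ≃* Equiv.Perm (Fin n)) := by
    intro K _ _ _
    have hsep : (ratPoly n a).Separable := hirr.separable
    have hsK : ((ratPoly n a).map (algebraMap ℚ K)).Splits :=
      IsSplittingField.splits K (ratPoly n a)
    have hgal : IsGalois ℚ K := IsGalois.of_separable_splitting_field hsep
    have hs : ((intPoly n a).map (algebraMap ℤ K)).Splits := by
      have : (intPoly n a).map (algebraMap ℤ K) = (ratPoly n a).map (algebraMap ℚ K) := by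
        rw [ratPoly, Polynomial.map_map]
        congr 1
        exact RingHom.ext_int _ _
      rwa [this]
    have hcard := (natCard_rootSet hm hs hsep).trans hd
    have hsurj := h K hs (isPretransitive_rootSet hm hirr) hcard
    have hinj := toPermHom_rootSet_injective (K := K) hm
      (IsSplittingField.adjoin_rootSet K (ratPoly n a))
    exact ⟨(MulEquiv.ofBijective _ ⟨hinj, hsurj⟩).trans
      (Finite.equivFinOfCardEq hcard).permCongrHom⟩
  have keyAlg : ∀ (L : Type) [Field L] [CharZero L] [alg : Algebra ℚ L],
      IsSplittingField ℚ L (ratPoly n a) → Nonempty ((L ≃ₐ[ℚ] L) ≃* Equiv.Perm (Fin n)) := by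
    intro L _ _ alg hL
    obtain rfl : alg = DivisionRing.toRatAlgebra := Subsingleton.elim _ _
    have hnf : NumberField L :=
      { to_charZero := inferInstance
        to_finiteDimensional := IsSplittingField.finiteDimensional L (ratPoly n a) }
    exact key L
  exact keyAlg _ (IsSplittingField.splittingField (ratPoly n a))

open NumberField in
theorem exists_frobenius_reduction {K : Type} [Field K] [NumberField K] [IsGalois ℚ K] {f : ℤ[X]}
    (hf : f.Monic) (hs : (f.map (algebraMap ℤ K)).Splits) {p : ℕ} (hp : p.Prime)
    (hsq : Squarefree (f.map (Int.castRingHom (ZMod p)))) :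
    ∃ (k : Type) (_ : Field k) (_ : Finite k) (_ : Algebra (ZMod p) k) (σ : K ≃ₐ[ℚ] K)
      (φ : f.rootSet (𝓞 K) ≃ (f.map (Int.castRingHom (ZMod p))).rootSet k),
      ∀ x, (φ (σ • x) : k) = (φ x : k) ^ p := by
  have : Fact p.Prime := ⟨hp⟩
  have hsO := splits_ringOfIntegers hf hs
  have hpmax : (Ideal.span {(p : ℤ)}).IsMaximal :=
    PrincipalIdealRing.isMaximal_of_irreducible (Nat.prime_iff_prime_int.mp hp).irreducible
  obtain ⟨P, hPmax, hPover⟩ :=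
    Ideal.exists_maximal_ideal_liesOver_of_isIntegral (S := 𝓞 K) (Ideal.span {(p : ℤ)})
  have hunder : P.under ℤ = Ideal.span {(p : ℤ)} := hPover.over.symm
  have hPbot : P ≠ ⊥ := by
    rintro rfl
    rw [Ideal.under_bot] at hunder
    have : (p : ℤ) ∈ (⊥ : Ideal ℤ) := hunder ▸ Ideal.mem_span_singleton_self _
    exact hp.ne_zero (by simpa using this)
  have hfin : Finite (𝓞 K ⧸ P) := Ideal.finiteQuotientOfFreeOfNeBot P hPbot
  let _ : Field (𝓞 K ⧸ P) := Ideal.Quotient.field P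
  have hp0 : ((p : ℕ) : 𝓞 K ⧸ P) = 0 := by
    have h1 : (p : ℤ) ∈ P.under ℤ := hunder ▸ Ideal.mem_span_singleton_self _
    have h2 : ((p : ℤ) : 𝓞 K) ∈ P := h1
    rw [Int.cast_natCast] at h2
    have h3 := Ideal.Quotient.eq_zero_iff_mem.mpr h2
    rwa [map_natCast] at h3
  have hchar : CharP (𝓞 K ⧸ P) p := by
    obtain ⟨q, hq⟩ := CharP.exists (𝓞 K ⧸ P)
    have hdvd := (CharP.cast_eq_zero_iff (𝓞 K ⧸ P) q p).mp hp0
    rcases (Nat.dvd_prime hp).mp hdvd with rfl | rfl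
    · exact absurd rfl (CharP.char_ne_one (𝓞 K ⧸ P) 1)
    · exact hq
  let _ : Algebra (ZMod p) (𝓞 K ⧸ P) := ZMod.algebra _ p
  obtain ⟨σ, hσ⟩ := IsArithFrobAt.exists_of_isInvariant ℤ (K ≃ₐ[ℚ] K) P
  have hcard : Nat.card (ℤ ⧸ P.under ℤ) = p := by
    rw [hunder, Nat.card_congr (Int.quotientSpanNatEquivZMod p).toEquiv, Nat.card_zmod]
  have hmapk : (f.map (Int.castRingHom (ZMod p))).map (algebraMap (ZMod p) (𝓞 K ⧸ P)) =
      (f.map (algebraMap ℤ (𝓞 K))).map (Ideal.Quotient.mk P) := by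
    rw [Polynomial.map_map, Polynomial.map_map]
    congr 1
    exact RingHom.ext_int _ _
  have hne : (f.map (algebraMap ℤ (𝓞 K))).map (Ideal.Quotient.mk P) ≠ 0 :=
    ((hf.map _).map _).ne_zero
  have hroots := hsO.roots_map_of_ne_zero hne
  have hnodup : ((f.map (algebraMap ℤ (𝓞 K))).map (Ideal.Quotient.mk P)).roots.Nodup := by
    rw [← hmapk]
    exact nodup_roots (PerfectField.separable_iff_squarefree.mpr hsq).map
  have hmem : ∀ y : 𝓞 K ⧸ P, y ∈ (f.map (Int.castRingHom (ZMod p))).rootSet (𝓞 K ⧸ P) ↔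
      y ∈ ((f.map (algebraMap ℤ (𝓞 K))).roots.map (Ideal.Quotient.mk P)) := by
    intro y
    rw [← hroots, ← hmapk, rootSet_def, Finset.mem_coe, Multiset.mem_toFinset, aroots_def]
  have hmem0 : ∀ x : 𝓞 K, x ∈ f.rootSet (𝓞 K) ↔ x ∈ (f.map (algebraMap ℤ (𝓞 K))).roots := by
    intro x
    rw [rootSet_def, Finset.mem_coe, Multiset.mem_toFinset, aroots_def]
  let φ₀ : f.rootSet (𝓞 K) → (f.map (Int.castRingHom (ZMod p))).rootSet (𝓞 K ⧸ P) := fun x =>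
    ⟨Ideal.Quotient.mk P x, (hmem _).mpr (Multiset.mem_map_of_mem _ ((hmem0 _).mp x.2))⟩
  have hφ₀ : Function.Bijective φ₀ := by
    constructor
    · intro x y hxy
      rw [hroots] at hnodup
      exact Subtype.ext (Multiset.inj_on_of_nodup_map hnodup _ ((hmem0 _).mp x.2) _
        ((hmem0 _).mp y.2) (congrArg Subtype.val hxy))
    · rintro ⟨y, hy⟩
      obtain ⟨x, hx, hxy⟩ := Multiset.mem_map.mp ((hmem y).mp hy)
      exact ⟨⟨x, (hmem0 x).mpr hx⟩, Subtype.ext hxy⟩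
  refine ⟨𝓞 K ⧸ P, inferInstance, hfin, inferInstance, σ, Equiv.ofBijective φ₀ hφ₀, fun x => ?_⟩
  have h1 := hσ.mk_apply (x : 𝓞 K)
  rw [hcard] at h1
  exact h1

theorem exists_pow_frobenius_eq {p : ℕ} [Fact p.Prime] {k : Type} [Field k] [Finite k]
    [Algebra (ZMod p) k] {h : (ZMod p)[X]} (hm : h.Monic) (hirr : Irreducible h) {α β : k}
    (hα : aeval α h = 0) (hβ : aeval β h = 0) : ∃ j : ℕ, α ^ p ^ j = β := by
  have h1 := minpoly.eq_of_irreducible_of_monic hirr hα hm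
  have h2 := minpoly.eq_of_irreducible_of_monic hirr hβ hm
  have hconj : IsConjRoot (ZMod p) β α := by rw [IsConjRoot, ← h1, ← h2]
  obtain ⟨τ, hτ⟩ := isConjRoot_iff_exists_algEquiv.mp hconj
  obtain ⟨j, hj⟩ := (FiniteField.bijective_frobeniusAlgEquivOfAlgebraic_pow (ZMod p) k).2 τ
  refine ⟨j, ?_⟩
  have hpow : ∀ (m : ℕ) (x : k),
      (FiniteField.frobeniusAlgEquivOfAlgebraic (ZMod p) k ^ m) x = x ^ p ^ m := by
    intro m
    induction m with
    | zero => simp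
    | succ m ih =>
      intro x
      rw [pow_succ, AlgEquiv.mul_apply, ih, FiniteField.coe_frobeniusAlgEquivOfAlgebraic,
        ← pow_mul, ZMod.card, pow_succ, mul_comm]
  rw [← hτ, ← hj, ← hpow]

theorem pow_prime_eq_self_iff {p : ℕ} [Fact p.Prime] {k : Type} [Field k] [Algebra (ZMod p) k]
    {x : k} : x ^ p = x ↔ ∃ c : ZMod p, algebraMap (ZMod p) k c = x := by
  have : CharP k p := charP_of_injective_algebraMap (algebraMap (ZMod p) k).injective p
  constructor
  · intro h
    have h1 := (Subfield.mem_bot_iff_pow_eq_self (F := k) (p := p)).mpr h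
    exact (bot_le : ⊥ ≤ (algebraMap (ZMod p) k).fieldRange) h1
  · rintro ⟨c, rfl⟩
    rw [← map_pow, ZMod.pow_card]

theorem natCard_linear_factors {p : ℕ} [Fact p.Prime] {g : (ZMod p)[X]} :
    Nat.card {h : (ZMod p)[X] // h.Monic ∧ Irreducible h ∧ h.natDegree = 1 ∧ h ∣ g} =
      Nat.card {c : ZMod p // g.IsRoot c} := by
  refine (Nat.card_congr (Equiv.ofBijective
    (fun c : {c : ZMod p // g.IsRoot c} => (⟨X - C c.1, monic_X_sub_C _, irreducible_X_sub_C _,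
      natDegree_X_sub_C _, dvd_iff_isRoot.mpr c.2⟩ :
      {h : (ZMod p)[X] // h.Monic ∧ Irreducible h ∧ h.natDegree = 1 ∧ h ∣ g})) ⟨?_, ?_⟩)).symm
  · intro c d hcd
    have := congrArg Subtype.val hcd
    simp only [sub_right_inj, C_inj] at this
    exact Subtype.ext this
  · rintro ⟨h, hm, -, hd, hdvd⟩
    have hX : h = X - C (-h.coeff 0) := by
      rw [C_neg, sub_neg_eq_add]
      exact hm.eq_X_add_C hd
    refine ⟨⟨-h.coeff 0, dvd_iff_isRoot.mp (hX ▸ hdvd)⟩, Subtype.ext hX.symm⟩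

theorem isRoot_algebraMap_iff {p : ℕ} [Fact p.Prime] {k : Type} [Field k] [Algebra (ZMod p) k]
    {g : (ZMod p)[X]} (hg : g ≠ 0) (c : ZMod p) :
    algebraMap (ZMod p) k c ∈ g.rootSet k ↔ g.IsRoot c := by
  rw [mem_rootSet_of_ne hg, aeval_algebraMap_apply, map_eq_zero_iff _ (algebraMap (ZMod p) k).injective,
    coe_aeval_eq_eval, IsRoot.def]

theorem exists_factor_of_splitType {p n : ℕ} {g : (ZMod p)[X]} {r : Fin n → ℕ}
    (h : SplitTypeOf g r) {i : Fin n} (hi : 1 ≤ r i) :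
    ∃ q : (ZMod p)[X], q.Monic ∧ Irreducible q ∧ q.natDegree = (i : ℕ) + 1 ∧ q ∣ g := by
  have h1 := h.2 i
  have : Nonempty {h : (ZMod p)[X] // h.Monic ∧ Irreducible h ∧
      h.natDegree = (i : ℕ) + 1 ∧ h ∣ g} := (Nat.card_pos_iff.mp (by omega)).1
  obtain ⟨q, hq⟩ := this
  exact ⟨q, hq⟩

theorem isSwap_of_fixed {X : Type*} [Fintype X] [DecidableEq X] (τ : Equiv.Perm X)
    (h : Nat.card {x // τ x = x} + 2 = Nat.card X) : τ.IsSwap := by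
  rw [← Equiv.Perm.card_support_eq_two]
  have h1 : Nat.card {x // τ x = x} = (univ.filter fun x => τ x = x).card := by
    rw [Nat.card_eq_fintype_card, Fintype.card_subtype]
  have h2 : τ.support = univ.filter fun x => ¬ τ x = x := by
    ext x
    simp
  have h3 := Finset.card_filter_add_card_filter_not (s := (univ : Finset X)) (fun x => τ x = x)
  rw [h2]
  rw [h1, Nat.card_eq_fintype_card, ← Finset.card_univ] at h
  omega

theorem isSnPoly_of_splitTypes {n : ℕ} (hn : 2 ≤ n) {a : Fin n → ℤ} {p₁ p₂ p₃ : ℕ}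
    (hp₁ : p₁.Prime) (hp₂ : p₂.Prime) (hp₃ : p₃.Prime) {r₁ r₂ r₃ : Fin n → ℕ}
    (hr₁ : r₁ ⟨n - 1, by omega⟩ = 1) (hr₂ : 1 ≤ r₂ ⟨n - 2, by omega⟩)
    (hr₃ : r₃ ⟨0, by omega⟩ = n - 2)
    (h₁ : HasSplitType n r₁ a p₁) (h₂ : HasSplitType n r₂ a p₂) (h₃ : HasSplitType n r₃ a p₃) :
    IsSnPoly n a := by
  have : Fact p₁.Prime := ⟨hp₁⟩
  have : Fact p₂.Prime := ⟨hp₂⟩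
  have : Fact p₃.Prime := ⟨hp₃⟩
  obtain ⟨hm, hd⟩ := intPoly_monic n a
  have hirr : Irreducible (ratPoly n a) := by
    obtain ⟨q, hqm, hqi, hqd, hq⟩ := exists_factor_of_splitType h₁ hr₁.ge
    have hfq : (intPoly n a).map (Int.castRingHom (ZMod p₁)) = q := by
      refine (eq_of_monic_of_dvd_of_natDegree_le hqm (hm.map _) hq ?_)
      rw [hm.natDegree_map, hd, hqd]
      simp only
      omega
    have hZ : Irreducible (intPoly n a) :=
      hm.irreducible_of_irreducible_map (Int.castRingHom (ZMod p₁)) _ (hfq ▸ hqi)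
    exact (hm.irreducible_iff_irreducible_map_fraction_map (K := ℚ)).mp hZ
  refine isSnPoly_of_surjective a hm hd hirr fun K _ _ _ hs htrans hcard => ?_
  rw [← MonoidHom.range_eq_top]
  have htwo : ∀ {u v c d : (intPoly n a).rootSet (NumberField.RingOfIntegers K)},
      u ≠ v → c ≠ d → ∃ g : K ≃ₐ[ℚ] K, g • u = c ∧ g • v = d := by
    intro u v c d huv hcd
    have hfrob := exists_frobenius_reduction hm hs hp₂ h₂.1
    obtain ⟨q, hqm, hqi, hqd, l, hql⟩ := exists_factor_of_splitType h₂ hr₂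
    have hgm : ((intPoly n a).map (Int.castRingHom (ZMod p₂))).Monic := hm.map _
    have hgd : ((intPoly n a).map (Int.castRingHom (ZMod p₂))).natDegree = n := by
      rw [hm.natDegree_map, hd]
    generalize (intPoly n a).map (Int.castRingHom (ZMod p₂)) = g at hfrob hql hgm hgd
    obtain ⟨k, _, _, _, σ, φ, hφ⟩ := hfrob
    have hlm : l.Monic := hqm.of_mul_monic_left (hql ▸ hgm)
    have hld : l.natDegree = 1 := by
      have h := hqm.natDegree_mul hlm
      rw [← hql, hqd, hgd] at h
      simp only at h
      omega
    have hlX : l = X - C (-l.coeff 0) := by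
      rw [C_neg, sub_neg_eq_add]
      exact hlm.eq_X_add_C hld
    set e := -l.coeff 0 with he
    have heroot : algebraMap (ZMod p₂) k e ∈ g.rootSet k := by
      rw [isRoot_algebraMap_iff hgm.ne_zero, ← dvd_iff_isRoot, ← hlX, hql]
      exact dvd_mul_left _ _
    let x₀ := φ.symm ⟨_, heroot⟩
    have hx₀ : (φ x₀ : k) = algebraMap (ZMod p₂) k e := by simp [x₀]
    have hσpow : ∀ (j : ℕ) x, (φ (σ ^ j • x) : k) = (φ x : k) ^ p₂ ^ j := by
      intro j
      induction j with
      | zero => simp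
      | succ j ih => intro x; rw [pow_succ', mul_smul, hφ, ih, ← pow_mul, pow_succ]
    have hfix : ∀ j : ℕ, σ ^ j • x₀ = x₀ := by
      have h1 : σ • x₀ = x₀ := φ.injective (Subtype.ext (by
        rw [hφ, pow_prime_eq_self_iff]
        exact ⟨e, hx₀.symm⟩))
      intro j
      induction j with
      | zero => simp
      | succ j ih => rw [pow_succ, mul_smul, h1, ih]
    have hqroot : ∀ x, x ≠ x₀ → aeval (φ x : k) q = 0 := by
      intro x hx
      have h1 : aeval (φ x : k) (q * l) = 0 :=
        (congrArg (aeval (φ x : k)) hql).symm.trans (mem_rootSet.mp (φ x).2).2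
      rw [map_mul, mul_eq_zero] at h1
      refine h1.resolve_right fun h2 => hx (φ.injective (Subtype.ext ?_))
      rw [hlX] at h2
      rw [hx₀]
      simpa [sub_eq_zero] using h2
    obtain ⟨g₁, hg₁⟩ := htrans.exists_smul_eq u x₀
    obtain ⟨g₂, hg₂⟩ := htrans.exists_smul_eq c x₀
    have hv : g₁ • v ≠ x₀ := fun h => huv (MulAction.injective g₁ (hg₁.trans h.symm))
    have hd' : g₂ • d ≠ x₀ := fun h => hcd (MulAction.injective g₂ (hg₂.trans h.symm))
    obtain ⟨j, hj⟩ := exists_pow_frobenius_eq hqm hqi (hqroot _ hv) (hqroot _ hd')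
    refine ⟨g₂⁻¹ * σ ^ j * g₁, ?_, ?_⟩
    · rw [mul_smul, mul_smul, hg₁, hfix, inv_smul_eq_iff, hg₂]
    · rw [mul_smul, mul_smul, inv_smul_eq_iff]
      exact φ.injective (Subtype.ext ((hσpow _ _).trans hj))
  have hprim : MulAction.IsPreprimitive (MulAction.toPermHom (K ≃ₐ[ℚ] K)
      ((intPoly n a).rootSet (NumberField.RingOfIntegers K))).range
      ((intPoly n a).rootSet (NumberField.RingOfIntegers K)) := by
    apply MulAction.isPreprimitive_of_is_two_pretransitive
    rw [MulAction.is_two_pretransitive_iff]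
    intro u v c d huv hcd
    obtain ⟨g, hg⟩ := htwo huv hcd
    exact ⟨⟨_, ⟨g, rfl⟩⟩, hg⟩
  obtain ⟨k, _, _, _, σ, φ, hφ⟩ := exists_frobenius_reduction hm hs hp₃ h₃.1
  refine Equiv.Perm.subgroup_eq_top_of_isPreprimitive_of_isSwap_mem hprim
    (MulAction.toPermHom _ _ σ) (isSwap_of_fixed _ ?_) ⟨σ, rfl⟩
  have hgne : (intPoly n a).map (Int.castRingHom (ZMod p₃)) ≠ 0 := (hm.map _).ne_zero
  have hroots : Nat.card {c : ZMod p₃ //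
      ((intPoly n a).map (Int.castRingHom (ZMod p₃))).IsRoot c} = n - 2 := by
    rw [← natCard_linear_factors, ← hr₃, ← h₃.2 ⟨0, by omega⟩]
  have hbij : Nat.card {x // MulAction.toPermHom (K ≃ₐ[ℚ] K)
      ((intPoly n a).rootSet (NumberField.RingOfIntegers K)) σ x = x} = n - 2 := by
    rw [← hroots]
    have hfixed : ∀ c : {c : ZMod p₃ //
        ((intPoly n a).map (Int.castRingHom (ZMod p₃))).IsRoot c},
        σ • φ.symm ⟨algebraMap (ZMod p₃) k c.1, (isRoot_algebraMap_iff hgne _).mpr c.2⟩ =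
          φ.symm ⟨algebraMap (ZMod p₃) k c.1, (isRoot_algebraMap_iff hgne _).mpr c.2⟩ := by
      intro c
      refine φ.injective (Subtype.ext ?_)
      rw [hφ, pow_prime_eq_self_iff]
      exact ⟨c.1, by simp⟩
    refine (Nat.card_congr (Equiv.ofBijective (fun c => ⟨_, hfixed c⟩) ⟨?_, ?_⟩)).symm
    · intro c d hcd
      have h1 := φ.symm.injective (congrArg Subtype.val hcd)
      exact Subtype.ext ((algebraMap (ZMod p₃) k).injective (congrArg Subtype.val h1))
    · rintro ⟨x, hx⟩
      have h1 : (φ x : k) ^ p₃ = φ x := by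
        rw [← hφ]
        exact congrArg (fun t => (φ t : k)) hx
      obtain ⟨c, hc⟩ := pow_prime_eq_self_iff.mp h1
      have hcr : algebraMap (ZMod p₃) k c ∈
          ((intPoly n a).map (Int.castRingHom (ZMod p₃))).rootSet k := hc ▸ (φ x).2
      refine ⟨⟨c, (isRoot_algebraMap_iff hgne _).mp hcr⟩, Subtype.ext ?_⟩
      change φ.symm _ = x
      rw [Equiv.symm_apply_eq]
      exact Subtype.ext hc
  rw [hbij, hcard]
  omega

open NumberField in
/-- The Galois group of a Galois number field is generated by its inertia subgroups. -/
theorem iSup_inertia_eq_top (K : Type) [Field K] [NumberField K] [IsGalois ℚ K] :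
    ⨆ m : MaximalSpectrum (𝓞 K), m.asIdeal.inertia (K ≃ₐ[ℚ] K) = ⊤ := by
  set H : Subgroup (K ≃ₐ[ℚ] K) :=
    ⨆ m : MaximalSpectrum (𝓞 K), m.asIdeal.inertia (K ≃ₐ[ℚ] K) with hH
  let F := IntermediateField.fixedField H
  have hFH : F.fixingSubgroup = H := IntermediateField.fixingSubgroup_fixedField H
  by_cases h1 : Module.finrank ℚ F = 1
  · have : F = ⊥ := IntermediateField.finrank_eq_one_iff.mp h1
    rw [← hFH, this, IntermediateField.fixingSubgroup_bot]
  exfalso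
  obtain ⟨P, hP, hram⟩ := NumberField.exists_not_isUnramifiedAt_int (𝒪 := 𝓞 F) h1
  obtain ⟨Q, hQ, hQP⟩ := Ideal.exists_maximal_ideal_liesOver_of_isIntegral (S := 𝓞 K) P
  have hle : Q.inertia (K ≃ₐ[ℚ] K) ≤ H :=
    le_iSup (fun m : MaximalSpectrum (𝓞 K) => m.asIdeal.inertia (K ≃ₐ[ℚ] K)) ⟨Q, hQ⟩
  have hgal : IsGaloisGroup H F K :=
    IsGaloisGroup.subgroup (K ≃ₐ[ℚ] K) ℚ K H
  have hgal' : IsGaloisGroup H (𝓞 F) (𝓞 K) := by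
    have : SMulDistribClass H (𝓞 K) K := ⟨fun g a b => smul_distrib_smul (g : K ≃ₐ[ℚ] K) a b⟩
    exact IsGaloisGroup.of_isFractionRing H (𝓞 F) (𝓞 K) F K
  have hp : (P.under ℤ).IsPrime := inferInstance
  have hl : Q.LiesOver (P.under ℤ) := Ideal.LiesOver.trans Q P (P.under ℤ)
  have c1 := Ideal.card_inertia_eq_ramificationIdxIn (G := K ≃ₐ[ℚ] K) (P.under ℤ) Q
  have c2 := Ideal.card_inertia_eq_ramificationIdxIn (G := H) P Q
  rw [Ideal.ramificationIdxIn_eq_ramificationIdx (P.under ℤ) Q (K ≃ₐ[ℚ] K)] at c1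
  rw [Ideal.ramificationIdxIn_eq_ramificationIdx P Q H] at c2
  have c3 : Nat.card (Q.inertia H) = Nat.card (Q.inertia (K ≃ₐ[ℚ] K)) :=
    Nat.card_congr (Subgroup.subgroupOfEquivOfLe hle).toEquiv
  have c4 := Ideal.ramificationIdx_tower (R := ℤ) P Q
  have c5 : 0 < Nat.card (Q.inertia H) := Nat.card_pos
  apply hram
  rw [← Ideal.ramificationIdx_eq_one_iff]
  rw [← c1, ← c2, c3] at c4
  rw [c3] at c5
  nlinarith

/-- Over any field, the Selmer trinomial has at most one repeated root, and that root is double. -/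
theorem selmer_card_roots_le {k : Type*} [Field k] {n : ℕ} (hn : 2 ≤ n) :
    (X ^ n - X - 1 : k[X]).roots.card ≤ (X ^ n - X - 1 : k[X]).roots.toFinset.card + 1 := by
  set g : k[X] := X ^ n - X - 1 with hg
  have key : ∀ α : k, 1 < g.rootMultiplicity α →
      ((n : k) - 1) * α = -n ∧ (n : k) - 1 ≠ 0 ∧ g.rootMultiplicity α < 3 := by
    intro α hα
    obtain ⟨m, rfl⟩ : ∃ m, n = m + 2 := ⟨n - 2, by omega⟩
    have e0 : IsRoot g α := by
      simpa using isRoot_iterate_derivative_of_lt_rootMultiplicity (n := 0) (by omega)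
    have e1 : IsRoot (derivative g) α := by
      simpa using isRoot_iterate_derivative_of_lt_rootMultiplicity (n := 1) hα
    simp only [hg, IsRoot.def, eval_sub, eval_pow, eval_X, eval_one, derivative_sub,
      derivative_X_pow, derivative_X, derivative_one, eval_mul, eval_C,
      sub_zero] at e0 e1
    push_cast at e0 e1 ⊢
    have e2 : ((m : k) + 2 - 1) * α = -(m + 2) := by
      linear_combination α * e1 - (m + 2) * e0
    have hne : (m : k) + 2 - 1 ≠ 0 := by
      intro h0
      rw [h0, zero_mul] at e2
      have : (1 : k) = 0 := by linear_combination e2 - h0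
      exact one_ne_zero this
    refine ⟨e2, hne, ?_⟩
    by_contra! h3
    have e3 : IsRoot (derivative (derivative g)) α := by
      simpa using isRoot_iterate_derivative_of_lt_rootMultiplicity (n := 2) h3
    have : m + 2 - 1 = m + 1 := rfl
    simp only [hg, IsRoot.def, eval_pow, eval_X, derivative_sub,
      derivative_X_pow, derivative_X, derivative_one, eval_mul, eval_C, derivative_mul,
      derivative_C, zero_mul, zero_add, this, Nat.add_sub_cancel, sub_zero] at e3
    push_cast at e3
    have h4 : ((m : k) + 2) * α ^ m = 0 := by
      have : ((m : k) + 2 - 1) * (((m : k) + 2) * α ^ m) = 0 := by linear_combination e3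
      exact (mul_eq_zero.mp this).resolve_left hne
    have : (1 : k) = 0 := by linear_combination α * h4 - e1
    exact one_ne_zero this
  by_cases hnd : g.roots.Nodup
  · rw [Multiset.toFinset_card_of_nodup hnd]; omega
  · rw [Multiset.nodup_iff_count_le_one] at hnd
    push Not at hnd
    obtain ⟨α, hα⟩ := hnd
    have hα' := hα
    rw [count_roots] at hα'
    have hk := key α hα'
    have hmem : α ∈ g.roots := Multiset.count_pos.mp (by omega)
    have hE : (g.roots.erase α).Nodup := by
      rw [Multiset.nodup_iff_count_le_one]
      intro β
      by_cases hβ : β = α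
      · subst hβ
        rw [Multiset.count_erase_self, count_roots]; omega
      · rw [Multiset.count_erase_of_ne hβ, count_roots]
        by_contra! h
        have hk' := key β h
        exact hβ (mul_left_cancel₀ hk.2.1 (hk'.1.trans hk.1.symm))
    have h1 := Multiset.card_erase_add_one hmem
    rw [← h1, ← Multiset.toFinset_card_of_nodup hE]
    gcongr
    exact Multiset.toFinset_subset.mpr (Multiset.erase_subset _ _)

/-- Coefficients of the Selmer trinomial `X ^ n - X - 1`. -/
def selmerCoeff (n : ℕ) : Fin n → ℤ := fun i => if (i : ℕ) ≤ 1 then -1 else 0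

theorem intPoly_selmerCoeff {n : ℕ} (hn : 2 ≤ n) : intPoly n (selmerCoeff n) = X ^ n - X - 1 := by
  obtain ⟨m, rfl⟩ : ∃ m, n = m + 2 := ⟨n - 2, by omega⟩
  simp only [intPoly, selmerCoeff, Fin.sum_univ_succ]
  simp
  ring

open NumberField in
theorem isSnPoly_selmerCoeff {n : ℕ} (hn : 2 ≤ n) : IsSnPoly n (selmerCoeff n) := by
  obtain ⟨hm, hd⟩ := intPoly_monic n (selmerCoeff n)
  apply isSnPoly_of_surjective _ hm hd
  · rw [ratPoly, intPoly_selmerCoeff hn]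
    simpa using X_pow_sub_X_sub_one_irreducible_rat (n := n) (by omega)
  intro K _ _ _ hs htr hcard
  have hs' := splits_ringOfIntegers hm hs
  apply hs'.surjective_toPermHom_of_iSup_inertia_eq_top _ (iSup_inertia_eq_top K)
  intro m
  have hmax := m.isMaximal
  let : Field (𝓞 K ⧸ m.asIdeal) := Ideal.Quotient.field _
  have hs'' : ((intPoly n (selmerCoeff n)).map (algebraMap ℤ (𝓞 K ⧸ m.asIdeal))).Splits := by
    rw [IsScalarTower.algebraMap_eq ℤ (𝓞 K) (𝓞 K ⧸ m.asIdeal), ← Polynomial.map_map]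
    exact hs'.map _
  have h1 := hs''.natDegree_eq_card_roots
  rw [hm.natDegree_map, hd] at h1
  have h2 := selmer_card_roots_le (k := 𝓞 K ⧸ m.asIdeal) hn
  have h3 : (intPoly n (selmerCoeff n)).map (algebraMap ℤ (𝓞 K ⧸ m.asIdeal)) = X ^ n - X - 1 := by
    rw [intPoly_selmerCoeff hn]; simp
  rw [← h3, ← h1] at h2
  rw [← Nat.card_coe_set_eq, hcard]
  refine h2.trans (le_of_eq ?_)
  rw [rootSet_def, Set.ncard_coe_finset, aroots_def]

theorem P0_nonempty {n N : ℕ} (hn : 2 ≤ n) (hN : 1 ≤ N) : (P0 n N).Nonempty := by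
  refine ⟨selmerCoeff n, ?_⟩
  simp only [P0, Finset.mem_filter, coeffBox, Fintype.mem_piFinset, Finset.mem_Icc]
  refine ⟨fun i => ?_, isSnPoly_selmerCoeff hn⟩
  unfold selmerCoeff
  split_ifs <;> constructor <;> omega

theorem primePi_eq_primeCounting (x : ℝ) : primePi x = Nat.primeCounting ⌊x⌋₊ := by
  rw [primePi, Nat.primeCounting, Nat.primeCounting', Nat.count_eq_card_filter_range]

theorem card_primesTo (x : ℝ) : (primesTo x).card = primePi x := rfl

theorem primePi_le {z : ℝ} (hz : 0 ≤ z) : (primePi z : ℝ) ≤ z := by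
  have h : primePi z ≤ ⌊z⌋₊ := by
    rw [← card_primesTo]
    calc (primesTo z).card ≤ (Finset.Icc 1 ⌊z⌋₊).card := by
          apply Finset.card_le_card
          intro p hp
          simp only [primesTo, Finset.mem_filter, Finset.mem_range] at hp
          rw [Finset.mem_Icc]
          exact ⟨hp.2.one_lt.le, by omega⟩
      _ = ⌊z⌋₊ := by simp
  calc (primePi z : ℝ) ≤ (⌊z⌋₊ : ℝ) := by exact_mod_cast h
    _ ≤ z := Nat.floor_le hz

theorem one_le_log {z : ℝ} (hz : 3 ≤ z) : 1 ≤ Real.log z := by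
  rw [Real.le_log_iff_exp_le (by linarith)]
  linarith [Real.exp_one_lt_d9]

theorem primePi_ge {z : ℝ} (hz : 3 ≤ z) : z / Real.log z / 16 ≤ primePi z := by
  have hlog := one_le_log hz
  rcases le_or_gt 5 z with h5 | h5
  · rw [primePi_eq_primeCounting]
    refine le_trans ?_ (Chebyshev.pi_ge' (by linarith))
    rw [div_div, mul_comm, ← div_div]
    apply div_le_div_of_nonneg_right _ (by linarith)
    have h8 : Real.log (z + 2) = Real.log ((z + 2) / 8) + 3 * Real.log 2 := by
      rw [Real.log_div (by linarith) (by norm_num), show (8 : ℝ) = 2 ^ 3 by norm_num, Real.log_pow]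
      push_cast; ring
    have h9 := Real.log_le_sub_one_of_pos (show 0 < (z + 2) / 8 by linarith)
    rw [h8]
    nlinarith [Real.log_two_gt_d9, Real.log_two_lt_d9]
  · have h1 : (1 : ℝ) ≤ primePi z := by
      have : 0 < primePi z := by
        rw [← card_primesTo]
        refine Finset.card_pos.mpr ⟨2, ?_⟩
        simp only [primesTo, Finset.mem_filter, Finset.mem_range]
        refine ⟨?_, Nat.prime_two⟩
        have : 2 ≤ ⌊z⌋₊ := Nat.le_floor (by push_cast; linarith)
        omega
      exact_mod_cast this
    have : z / Real.log z ≤ z := div_le_self (by linarith) hlog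
    linarith

theorem loglog_three_pos : 0 < Real.log (Real.log 3) := by
  apply Real.log_pos
  rw [Real.lt_log_iff_exp_lt (by norm_num)]
  linarith [Real.exp_one_lt_d9]

theorem loglog_ge {z : ℝ} (hz : 3 ≤ z) : Real.log (Real.log 3) ≤ Real.log (Real.log z) := by
  apply Real.log_le_log (by linarith [one_le_log le_rfl])
  exact Real.log_le_log (by norm_num) hz

theorem primePi_two_pow_le {m : ℕ} (hm : 1 ≤ m) :
    (primePi (2 ^ m) : ℝ) ≤ 6 * 2 ^ m / m := by
  have h := Chebyshev.pi_le_log4_mul_div (x := 2 ^ m) (one_lt_pow₀ (by norm_num) (by omega))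
  rw [← primePi_eq_primeCounting] at h
  refine h.trans ?_
  have hl2 : 0 < Real.log 2 := Real.log_pos (by norm_num)
  have hm0 : (0 : ℝ) < m := by exact_mod_cast hm
  have hs : Real.sqrt (2 ^ m) * Real.sqrt (2 ^ m) = 2 ^ m := Real.mul_self_sqrt (by positivity)
  have hs0 : 0 < Real.sqrt (2 ^ m) := Real.sqrt_pos.mpr (by positivity)
  have hsm : (m : ℝ) / 2 ≤ Real.sqrt (2 ^ m) := by
    apply Real.le_sqrt_of_sq_le
    have : ∀ m : ℕ, (m : ℝ) ^ 2 ≤ 4 * 2 ^ m := by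
      intro m
      induction m using Nat.strong_induction_on with
      | _ m ih =>
        rcases lt_or_ge m 4 with h4 | h4
        · interval_cases m <;> norm_num
        · obtain ⟨l, rfl⟩ : ∃ l, m = l + 1 := ⟨m - 1, by omega⟩
          have := ih l (by omega)
          have h3 : (3 : ℝ) ≤ l := by exact_mod_cast (by omega : 3 ≤ l)
          push_cast
          rw [pow_succ (2 : ℝ)]
          nlinarith
    nlinarith [this m]
  have h4 : Real.log 4 = 2 * Real.log 2 := by
    rw [show (4 : ℝ) = 2 ^ 2 by norm_num, Real.log_pow]; push_cast; ring
  rw [Real.log_sqrt (by positivity), Real.log_pow, h4]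
  have e1 : 2 * Real.log 2 * 2 ^ m / (m * Real.log 2 / 2) = 4 * 2 ^ m / m := by
    field_simp; ring
  have e2 : Real.sqrt (2 ^ m) ≤ 2 * 2 ^ m / m := by
    rw [le_div_iff₀ hm0]
    nlinarith
  rw [e1]
  calc 4 * 2 ^ m / (m : ℝ) + Real.sqrt (2 ^ m) ≤ 4 * 2 ^ m / m + 2 * 2 ^ m / m := by linarith
    _ = 6 * 2 ^ m / m := by ring

theorem mem_primesTo {z : ℝ} (hz : 0 ≤ z) {p : ℕ} : p ∈ primesTo z ↔ p.Prime ∧ (p : ℝ) ≤ z := by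
  simp only [primesTo, Finset.mem_filter, Finset.mem_range, Nat.lt_succ_iff, Nat.le_floor_iff hz]
  tauto

theorem primesTo_mono {x y : ℝ} (h : x ≤ y) : primesTo x ⊆ primesTo y := by
  intro p hp
  simp only [primesTo, Finset.mem_filter, Finset.mem_range] at hp ⊢
  exact ⟨lt_of_lt_of_le hp.1 (by gcongr), hp.2⟩

theorem sum_inv_primes_two_pow (J : ℕ) :
    ∑ p ∈ primesTo ((2 : ℝ) ^ J), (1 : ℝ) / p ≤ 12 * harmonic J := by
  induction J with
  | zero =>
    have : primesTo ((2 : ℝ) ^ 0) = ∅ := by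
      ext p
      rw [mem_primesTo (by positivity)]
      simp only [pow_zero, Finset.notMem_empty, iff_false, not_and, not_le]
      intro hp
      exact_mod_cast hp.one_lt
    rw [this]; simp
  | succ J ih =>
    have hsub := primesTo_mono (pow_le_pow_right₀ (by norm_num : (1 : ℝ) ≤ 2) (Nat.le_succ J))
    rw [← Finset.sum_sdiff hsub, harmonic_succ]
    have h1 : ∑ p ∈ primesTo ((2 : ℝ) ^ (J + 1)) \ primesTo ((2 : ℝ) ^ J), (1 : ℝ) / p ≤
        primePi (2 ^ (J + 1)) * (1 / 2 ^ J) := by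
      rw [← card_primesTo]
      calc _ ≤ ∑ p ∈ primesTo ((2 : ℝ) ^ (J + 1)) \ primesTo ((2 : ℝ) ^ J), (1 : ℝ) / 2 ^ J := by
            apply Finset.sum_le_sum
            intro p hp
            rw [Finset.mem_sdiff, mem_primesTo (by positivity), mem_primesTo (by positivity)] at hp
            have : (2 : ℝ) ^ J < p := by
              by_contra! h
              exact hp.2 ⟨hp.1.1, h⟩
            gcongr
        _ ≤ _ := by
            rw [Finset.sum_const, nsmul_eq_mul]
            gcongr
            exact Finset.sdiff_subset
    have h2 := primePi_two_pow_le (m := J + 1) (by omega)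
    have h3 : (primePi (2 ^ (J + 1)) : ℝ) * (1 / 2 ^ J) ≤ 12 * ((J + 1 : ℕ) : ℝ)⁻¹ := by
      calc _ ≤ 6 * 2 ^ (J + 1) / ((J + 1 : ℕ) : ℝ) * (1 / 2 ^ J) := by gcongr
        _ = _ := by rw [pow_succ]; field_simp; ring
    push_cast at h3 ⊢
    linarith

/-- Upper bound of Mertens type for the sum of reciprocals of the primes. -/
theorem exists_sum_inv_primes_le :
    ∃ C > (0 : ℝ), ∀ z : ℝ, 3 ≤ z →
      ∑ p ∈ primesTo z, (1 : ℝ) / p ≤ C * Real.log (Real.log z) := by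
  refine ⟨12 + 36 / Real.log (Real.log 3), by have := loglog_three_pos; positivity, ?_⟩
  intro z hz
  have hl := one_le_log hz
  have hl2 := Real.log_two_gt_d9
  set J := ⌈Real.log z / Real.log 2⌉₊ with hJ
  have hzJ : z ≤ 2 ^ J := by
    have := Nat.le_ceil (Real.log z / Real.log 2)
    rw [div_le_iff₀ (by linarith), ← hJ] at this
    rw [← Real.log_le_log_iff (by linarith) (by positivity), Real.log_pow]
    exact this
  have hJ3 : (J : ℝ) ≤ 3 * Real.log z := by
    have h1 := Nat.ceil_lt_add_one (show 0 ≤ Real.log z / Real.log 2 by positivity)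
    have h2 : Real.log z / Real.log 2 ≤ 2 * Real.log z := by
      rw [div_le_iff₀ (by linarith)]; nlinarith
    linarith
  have hJ0 : 0 < (J : ℝ) := by
    have : 0 < J := Nat.ceil_pos.mpr (by positivity)
    exact_mod_cast this
  have h1 : ∑ p ∈ primesTo z, (1 : ℝ) / p ≤ 12 * harmonic J :=
    (Finset.sum_le_sum_of_subset_of_nonneg (primesTo_mono hzJ)
      (fun _ _ _ => by positivity)).trans (sum_inv_primes_two_pow J)
  have h2 := harmonic_le_one_add_log J
  have h3 : Real.log J ≤ Real.log 3 + Real.log (Real.log z) := by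
    rw [← Real.log_mul (by norm_num) (by linarith)]
    exact Real.log_le_log hJ0 hJ3
  have h4 : Real.log 3 ≤ 2 := by
    linarith [Real.log_le_sub_one_of_pos (show (0 : ℝ) < 3 by norm_num)]
  have h5 : 36 ≤ 36 / Real.log (Real.log 3) * Real.log (Real.log z) := by
    rw [div_mul_eq_mul_div, le_div_iff₀ loglog_three_pos]
    linarith [loglog_ge hz]
  linarith

theorem eventually_loglog_le_primePi (A : ℝ) :
    ∀ᶠ z in atTop, A * Real.log (Real.log z) ≤ primePi z := by
  have h := (Real.isLittleO_pow_log_id_atTop (n := 2)).bound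
    (show (0 : ℝ) < 1 / (16 * (|A| + 1)) by positivity)
  filter_upwards [h, eventually_ge_atTop 3] with z hz h3
  have hl := one_le_log h3
  have hz0 : (0 : ℝ) < z := by linarith
  refine le_trans ?_ (primePi_ge h3)
  simp only [id, Real.norm_eq_abs, abs_of_pos hz0, abs_of_nonneg (sq_nonneg (Real.log z))] at hz
  have hll : Real.log (Real.log z) ≤ Real.log z :=
    (Real.log_le_sub_one_of_pos (by linarith)).trans (by linarith)
  have hll0 : 0 ≤ Real.log (Real.log z) := Real.log_nonneg hl
  rw [div_div, le_div_iff₀ (by positivity)]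
  rw [one_div_mul_eq_div, le_div_iff₀ (by positivity)] at hz
  have hA : A * Real.log (Real.log z) ≤ (|A| + 1) * Real.log z :=
    mul_le_mul (by linarith [le_abs_self A]) hll hll0 (by positivity)
  nlinarith

theorem splitDelta_pos (n : ℕ) (r : Fin n → ℕ) : 0 < splitDelta n r := by
  unfold splitDelta
  exact Finset.prod_pos fun i _ => by positivity

theorem abs_sum_sub_le_of_near {f : ℕ → ℝ} {a : ℝ} (h : NearAtPrimes f a) :
    ∃ C > (0 : ℝ), ∀ z : ℝ, 3 ≤ z →
      |∑ p ∈ primesTo z, f p - a * primePi z| ≤ C * Real.log (Real.log z) := by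
  obtain ⟨D, hD0, hD⟩ := h
  obtain ⟨M, hM0, hM⟩ := exists_sum_inv_primes_le
  refine ⟨(D + 1) * M, by positivity, fun z hz => ?_⟩
  have e : ∑ p ∈ primesTo z, f p - a * primePi z = ∑ p ∈ primesTo z, (f p - a) := by
    rw [Finset.sum_sub_distrib, Finset.sum_const, card_primesTo, nsmul_eq_mul]; ring
  rw [e]
  calc |∑ p ∈ primesTo z, (f p - a)| ≤ ∑ p ∈ primesTo z, |f p - a| := Finset.abs_sum_le_sum_abs _ _
    _ ≤ ∑ p ∈ primesTo z, (D + 1) * (1 / p) := by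
        apply Finset.sum_le_sum
        intro p hp
        refine (hD p (prime_of_mem_primesTo hp)).trans ?_
        rw [mul_one_div]
        gcongr
        linarith
    _ = (D + 1) * ∑ p ∈ primesTo z, (1 : ℝ) / p := by rw [Finset.mul_sum]
    _ ≤ (D + 1) * (M * Real.log (Real.log z)) := by gcongr; exact hM z hz
    _ = _ := by ring

theorem boxAvg_nonneg_bound {n N : ℕ} {F : (Fin n → ℤ) → ℝ} (hF : ∀ a, 0 ≤ F a)
    {S : Finset (Fin n → ℤ)} (hS : S ⊆ coeffBox n N) {w : ℝ} (hw : ∀ a ∈ S, w ≤ F a) :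
    (S.card : ℝ) * w ≤ boxAvg n N F * (2 * N + 1 : ℝ) ^ n := by
  rw [boxAvg, div_mul_cancel₀ _ (by positivity)]
  calc (S.card : ℝ) * w = ∑ a ∈ S, w := by rw [Finset.sum_const, nsmul_eq_mul]
    _ ≤ ∑ a ∈ S, F a := Finset.sum_le_sum hw
    _ ≤ _ := Finset.sum_le_sum_of_subset_of_nonneg hS fun a _ _ => hF a

/-- Few polynomials avoid a given splitting type at every prime. -/
theorem exists_card_avoid_splitType_le (n : ℕ) (r : Fin n → ℕ)
    (hr : ∑ i : Fin n, ((i : ℕ) + 1) * r i = n) :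
    ∃ C > (0 : ℝ), ∀ N : ℕ, 1 ≤ N →
      (((coeffBox n N).filter fun a => ∀ p, p.Prime → ¬ HasSplitType n r a p).card : ℝ) ≤
        C * (N : ℝ) ^ (-(1 / 8) : ℝ) * (2 * N + 1 : ℝ) ^ n := by
  have hδ := splitDelta_pos n r
  set δ := splitDelta n r with hδdef
  obtain ⟨D, hD0, hD⟩ := abs_sum_sub_le_of_near (locDelta_near hr)
  obtain ⟨z₀, hz₀⟩ := eventually_atTop.mp (eventually_loglog_le_primePi (2 * D / δ))
  set z₁ := max z₀ 3 with hz₁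
  have hz₁3 : 3 ≤ z₁ := le_max_right _ _
  refine ⟨Real.sqrt z₁ + 4 / δ ^ 2 * (32 + n), by positivity, fun N hN => ?_⟩
  have hN0 : (0 : ℝ) < N := by exact_mod_cast hN
  set S := (coeffBox n N).filter fun a => ∀ p, p.Prime → ¬ HasSplitType n r a p with hS
  have hSsub : S ⊆ coeffBox n N := Finset.filter_subset _ _
  set z : ℝ := (N : ℝ) ^ (1 / 4 : ℝ) with hz
  have hz0 : 0 < z := by positivity
  have hpow : (N : ℝ) ^ (-(1 / 8) : ℝ) = 1 / Real.sqrt z := by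
    rw [Real.sqrt_eq_rpow, hz, ← Real.rpow_mul hN0.le, one_div ((N : ℝ) ^ _), ← Real.rpow_neg hN0.le]
    norm_num
  have hcard : (S.card : ℝ) ≤ (2 * N + 1 : ℝ) ^ n := by
    rw [← card_coeffBox]; exact_mod_cast Finset.card_le_card hSsub
  rcases lt_or_ge z z₁ with hlt | hge
  · refine hcard.trans ?_
    apply le_mul_of_one_le_left (by positivity)
    rw [hpow, mul_one_div, one_le_div (Real.sqrt_pos.mpr hz0)]
    have h1 : Real.sqrt z ≤ Real.sqrt z₁ := Real.sqrt_le_sqrt hlt.le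
    have h2 : 0 ≤ 4 / δ ^ 2 * (32 + n) := by positivity
    linarith
  · have hz3 : 3 ≤ z := hz₁3.trans hge
    have hl := one_le_log hz3
    have hπ := primePi_ge hz3
    have hπ0 : (0 : ℝ) < primePi z := lt_of_lt_of_le (by positivity) hπ
    have h1 := hD z hz3
    have h2 := hz₀ z ((le_max_left _ _).trans hge)
    set W := ∑ p ∈ primesTo z, locDelta n r p with hW
    have hWge : δ / 2 * primePi z ≤ W := by
      rw [div_mul_eq_mul_div, div_le_iff₀ hδ] at h2
      have := (abs_le.mp h1).1
      linarith
    have hm := (abs_le.mp (box_second_moment (n := n) (N := N) hN r (z := z) (by linarith))).2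
    have hV : totalVar n r z ≤ primePi z := by
      rw [totalVar, ← card_primesTo]
      calc _ ≤ ∑ p ∈ primesTo z, (1 : ℝ) :=
            Finset.sum_le_sum fun p hp => locVar_le_one n r p
        _ = (primesTo z).card := by simp
    have hb := boxAvg_nonneg_bound (N := N) (F := fun a => (∑ p ∈ primesTo z, Yp n r p a) ^ 2)
      (fun a => sq_nonneg _) hSsub (w := W ^ 2) (by
        intro a ha
        rw [hS, Finset.mem_filter] at ha
        have : ∑ p ∈ primesTo z, Yp n r p a = -W := by
          rw [hW, ← Finset.sum_neg_distrib]
          apply Finset.sum_congr rfl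
          intro p hp
          rw [Yp_eq, if_neg (ha.2 p (prime_of_mem_primesTo hp)), zero_sub]
        rw [this, neg_sq])
    have hB : 0 < (2 * N + 1 : ℝ) ^ n := by positivity
    have hb2 : (S.card : ℝ) * (δ / 2 * primePi z) ^ 2 ≤
        (primePi z + (primePi z : ℝ) ^ 2 * (n * z ^ 2 / N)) * (2 * N + 1 : ℝ) ^ n := by
      calc _ ≤ (S.card : ℝ) * W ^ 2 := by gcongr
        _ ≤ _ := hb
        _ ≤ _ := by gcongr; linarith
    have hzN : z ^ 2 / N = 1 / z ^ 2 := by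
      rw [div_eq_div_iff hN0.ne' (by positivity), one_mul, ← pow_add, hz, ← Real.rpow_natCast,
        ← Real.rpow_mul hN0.le]
      norm_num
    have hs : Real.sqrt z * Real.sqrt z = z := Real.mul_self_sqrt hz0.le
    have hs1 : 1 ≤ Real.sqrt z := Real.one_le_sqrt.mpr (by linarith)
    have hinv : 1 / (primePi z : ℝ) ≤ 32 / Real.sqrt z := by
      have hlz : Real.log z ≤ 2 * Real.sqrt z := by
        have := Real.log_le_sub_one_of_pos (show 0 < Real.sqrt z by positivity)
        rw [Real.log_sqrt hz0.le] at this
        linarith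
      rw [div_div, div_le_iff₀ (by positivity)] at hπ
      rw [div_le_div_iff₀ hπ0 (by positivity)]
      have : Real.sqrt z * Real.sqrt z ≤ 32 * primePi z * Real.sqrt z := by
        rw [hs]; nlinarith
      nlinarith
    have hz2 : n * z ^ 2 / N ≤ n / Real.sqrt z := by
      rw [mul_div_assoc, hzN, mul_one_div]
      gcongr
      nlinarith
    have key : (S.card : ℝ) ≤ 4 / δ ^ 2 * (1 / primePi z + n * z ^ 2 / N) * (2 * N + 1 : ℝ) ^ n := by
      have hq : 0 < (δ / 2 * primePi z) ^ 2 := by positivity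
      rw [← le_div_iff₀ hq] at hb2
      refine hb2.trans (le_of_eq ?_)
      field_simp
      norm_num
    refine key.trans (mul_le_mul_of_nonneg_right ?_ hB.le)
    rw [hpow, mul_one_div]
    calc 4 / δ ^ 2 * (1 / primePi z + n * z ^ 2 / N)
        ≤ 4 / δ ^ 2 * (32 / Real.sqrt z + n / Real.sqrt z) := by gcongr
      _ = 4 / δ ^ 2 * (32 + n) / Real.sqrt z := by ring
      _ ≤ _ := by gcongr; linarith [Real.sqrt_nonneg z₁]

/-- All but a power-saving proportion of the coefficient box consists of `S_n`-polynomials. -/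
theorem exists_card_sdiff_P0_le {n : ℕ} (hn : 2 ≤ n) :
    ∃ C > (0 : ℝ), ∀ N : ℕ, 1 ≤ N →
      ((coeffBox n N \ P0 n N).card : ℝ) ≤
        C * (N : ℝ) ^ (-(1 / 8) : ℝ) * (2 * N + 1 : ℝ) ^ n := by
  let r₁ : Fin n → ℕ := Pi.single ⟨n - 1, by omega⟩ 1
  let r₂ : Fin n → ℕ := Pi.single ⟨0, by omega⟩ 1 + Pi.single ⟨n - 2, by omega⟩ 1
  let r₃ : Fin n → ℕ := Pi.single ⟨0, by omega⟩ (n - 2) + Pi.single ⟨1, by omega⟩ 1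
  have hsingle : ∀ (j : Fin n) (m : ℕ),
      ∑ i : Fin n, ((i : ℕ) + 1) * (Pi.single j m : Fin n → ℕ) i = ((j : ℕ) + 1) * m := by
    intro j m
    rw [Finset.sum_eq_single j]
    · simp
    · intro i _ hi; simp [Pi.single_eq_of_ne hi]
    · simp
  have hr₁ : ∑ i : Fin n, ((i : ℕ) + 1) * r₁ i = n := by
    rw [hsingle]; simp; omega
  have hr₂ : ∑ i : Fin n, ((i : ℕ) + 1) * r₂ i = n := by
    simp only [r₂, Pi.add_apply, mul_add, Finset.sum_add_distrib, hsingle]; omega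
  have hr₃ : ∑ i : Fin n, ((i : ℕ) + 1) * r₃ i = n := by
    simp only [r₃, Pi.add_apply, mul_add, Finset.sum_add_distrib, hsingle]; omega
  obtain ⟨C₁, hC₁, h₁⟩ := exists_card_avoid_splitType_le n r₁ hr₁
  obtain ⟨C₂, hC₂, h₂⟩ := exists_card_avoid_splitType_le n r₂ hr₂
  obtain ⟨C₃, hC₃, h₃⟩ := exists_card_avoid_splitType_le n r₃ hr₃
  refine ⟨C₁ + C₂ + C₃, by positivity, fun N hN => ?_⟩
  let S (r : Fin n → ℕ) := (coeffBox n N).filter fun a => ∀ p, p.Prime → ¬ HasSplitType n r a p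
  have hsub : coeffBox n N \ P0 n N ⊆ S r₁ ∪ S r₂ ∪ S r₃ := by
    intro a ha
    simp only [P0, Finset.mem_sdiff, Finset.mem_filter, not_and] at ha
    simp only [S, Finset.mem_union, Finset.mem_filter]
    by_contra! hcon
    obtain ⟨⟨k₁, k₂⟩, k₃⟩ := hcon
    obtain ⟨p₁, hp₁, t₁⟩ := k₁ ha.1
    obtain ⟨p₂, hp₂, t₂⟩ := k₂ ha.1
    obtain ⟨p₃, hp₃, t₃⟩ := k₃ ha.1
    refine ha.2 ha.1 (isSnPoly_of_splitTypes hn hp₁ hp₂ hp₃ ?_ ?_ ?_ t₁ t₂ t₃)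
    · simp [r₁]
    · simp [r₂]
    · simp [r₃]
  have hc : (coeffBox n N \ P0 n N).card ≤ (S r₁).card + (S r₂).card + (S r₃).card :=
    (Finset.card_le_card hsub).trans
      ((Finset.card_union_le _ _).trans (Nat.add_le_add_right (Finset.card_union_le _ _) _))
  have hc' : ((coeffBox n N \ P0 n N).card : ℝ) ≤ (S r₁).card + (S r₂).card + (S r₃).card := by
    exact_mod_cast hc
  have := h₁ N hN
  have := h₂ N hN
  have := h₃ N hN
  simp only [S] at hc'
  linarith

theorem splitDelta_lt_one {n : ℕ} (hn : 2 ≤ n) {r : Fin n → ℕ}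
    (hr : ∑ i : Fin n, ((i : ℕ) + 1) * r i = n) : splitDelta n r < 1 := by
  unfold splitDelta
  rw [Finset.prod_div_distrib, Finset.prod_const_one, ← Nat.cast_prod]
  have hpos : ∀ i : Fin n, 1 ≤ ((i : ℕ) + 1) ^ (r i) * Nat.factorial (r i) := fun i =>
    Nat.mul_pos (by positivity) (Nat.factorial_pos _)
  have h1 : 1 < ∏ i : Fin n, ((i : ℕ) + 1) ^ (r i) * Nat.factorial (r i) := by
    by_contra! hle
    have hall : ∀ i : Fin n, ((i : ℕ) + 1) ^ (r i) * Nat.factorial (r i) ≤ 1 := fun i =>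
      (Finset.single_le_prod' (f := fun i : Fin n => ((i : ℕ) + 1) ^ (r i) * Nat.factorial (r i))
        (fun i _ => hpos i) (Finset.mem_univ i)).trans hle
    have hz : ∀ i : Fin n, i ≠ ⟨0, by omega⟩ → r i = 0 := by
      intro i hi
      by_contra hri
      have hi0 : (i : ℕ) ≠ 0 := fun h => hi (Fin.ext h)
      have h2 : 2 ≤ ((i : ℕ) + 1) ^ (r i) :=
        (show 2 ≤ (i : ℕ) + 1 by omega).trans (Nat.le_self_pow hri _)
      have := Nat.mul_le_mul h2 (Nat.factorial_pos (r i))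
      have := hall i
      omega
    have h0 : r ⟨0, by omega⟩ ≤ 1 := by
      have h := (Nat.le_mul_of_pos_left _ (by positivity)).trans (hall ⟨0, by omega⟩)
      exact (Nat.self_le_factorial _).trans h
    rw [Finset.sum_eq_single ⟨0, by omega⟩ (fun i _ hi => by rw [hz i hi, mul_zero])
      (fun h => absurd (Finset.mem_univ _) h)] at hr
    simp only [zero_add, one_mul] at hr
    omega
  rw [div_lt_one (by positivity)]
  exact_mod_cast h1

theorem locVar_near {n : ℕ} (hn : 2 ≤ n) {r : Fin n → ℕ}
    (hr : ∑ i : Fin n, ((i : ℕ) + 1) * r i = n) :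
    NearAtPrimes (locVar n r) (splitDelta n r - splitDelta n r ^ 2) := by
  obtain ⟨C, hC0, hC⟩ := locDelta_near hr
  refine ⟨C, hC0, fun p hp => (le_trans ?_ (hC p hp))⟩
  have e : locVar n r p - (splitDelta n r - splitDelta n r ^ 2) =
      (locDelta n r p - splitDelta n r) * (1 - locDelta n r p - splitDelta n r) := by
    rw [locVar]; ring
  rw [e, abs_mul]
  apply mul_le_of_le_one_right (abs_nonneg _)
  have h1 := locDelta_nonneg n r p
  have h2 := locDelta_le_one (n := n) (r := r) hp
  have h3 := splitDelta_pos n r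
  have h4 := splitDelta_lt_one hn hr
  rw [abs_le]
  constructor <;> linarith

theorem abs_expN_sub_boxAvg_le {n N : ℕ} {F : (Fin n → ℤ) → ℝ} {s : ℝ}
    (hF : ∀ a, |F a| ≤ s) (hne : (P0 n N).Nonempty) :
    |expN n N F - boxAvg n N F| ≤
      2 * s * ((coeffBox n N \ P0 n N).card / (2 * N + 1 : ℝ) ^ n) := by
  have hsub : P0 n N ⊆ coeffBox n N := Finset.filter_subset _ _
  have hp : (0 : ℝ) < (P0 n N).card := by exact_mod_cast hne.card_pos
  have hb : (0 : ℝ) < (2 * N + 1 : ℝ) ^ n := by positivity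
  have hcard : ((coeffBox n N \ P0 n N).card : ℝ) + (P0 n N).card = (2 * N + 1 : ℝ) ^ n := by
    rw [← card_coeffBox]; exact_mod_cast Finset.card_sdiff_add_card_eq_card hsub
  have hbound : ∀ S : Finset (Fin n → ℤ), |∑ a ∈ S, F a| ≤ S.card * s := by
    intro S
    calc _ ≤ ∑ a ∈ S, |F a| := Finset.abs_sum_le_sum_abs _ _
      _ ≤ ∑ a ∈ S, s := Finset.sum_le_sum fun a _ => hF a
      _ = _ := by rw [Finset.sum_const, nsmul_eq_mul]
  rw [expN, boxAvg, ← Finset.sum_sdiff hsub]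
  have h1 := hbound (coeffBox n N \ P0 n N)
  have h2 := hbound (P0 n N)
  set q : ℝ := ((coeffBox n N \ P0 n N).card : ℝ)
  set P : ℝ := ((P0 n N).card : ℝ)
  set B : ℝ := (2 * N + 1 : ℝ) ^ n
  set R := ∑ a ∈ coeffBox n N \ P0 n N, F a
  set S := ∑ a ∈ P0 n N, F a
  have hq : 0 ≤ q := Nat.cast_nonneg _
  have e : S / P - (R + S) / B = (S * q / P - R) / B := by
    rw [← hcard]
    have : q + P ≠ 0 := by positivity
    field_simp
    ring
  rw [e, abs_div, abs_of_pos hb, ← mul_div_assoc]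
  gcongr
  calc |S * q / P - R| ≤ |S * q / P| + |R| := abs_sub _ _
    _ = |S| * q / P + |R| := by rw [abs_div, abs_mul, abs_of_pos hp, abs_of_nonneg hq]
    _ ≤ P * s * q / P + q * s := by gcongr
    _ = 2 * s * q := by field_simp; ring

theorem abs_pow_sub_one_le {ρ e : ℝ} {j : ℕ} (hρ : 0 ≤ ρ) (h : |ρ - 1| ≤ e) (hje : j * e ≤ 1) :
    |ρ ^ j - 1| ≤ 2 * (j * e) := by
  have he : 0 ≤ e := (abs_nonneg _).trans h
  have hj : (0 : ℝ) ≤ j * e := by positivity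
  rw [abs_le] at h ⊢
  constructor
  · have := one_add_mul_le_pow (show -2 ≤ ρ - 1 by linarith) j
    rw [add_sub_cancel] at this
    have h2 : -(j * e) ≤ j * (ρ - 1) := by
      rw [← mul_neg]; exact mul_le_mul_of_nonneg_left h.1 (Nat.cast_nonneg j)
    linarith
  · have h1 : ρ ^ j ≤ Real.exp (j * e) := by
      rw [Real.exp_nat_mul]
      exact pow_le_pow_left₀ hρ (by linarith [Real.add_one_le_exp e, h.2]) j
    have h2 := (abs_le.mp (Real.abs_exp_sub_one_le (x := j * e) (by rwa [abs_of_nonneg hj]))).2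
    rw [abs_of_nonneg hj] at h2
    linarith

theorem abs_sum_Yp_pow_le (n : ℕ) (r : Fin n → ℕ) {z : ℝ} (hz : 0 ≤ z) (a : Fin n → ℤ) (k : ℕ) :
    |(∑ p ∈ primesTo z, Yp n r p a) ^ k| ≤ z ^ k := by
  rw [abs_pow]
  gcongr
  calc |∑ p ∈ primesTo z, Yp n r p a| ≤ ∑ p ∈ primesTo z, |Yp n r p a| :=
        Finset.abs_sum_le_sum_abs _ _
    _ ≤ ∑ p ∈ primesTo z, (1 : ℝ) :=
        Finset.sum_le_sum fun p hp => abs_Yp_le_one n r (prime_of_mem_primesTo hp) a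
    _ = primePi z := by simp [card_primesTo]
    _ ≤ z := primePi_le hz

/-- The Gaussian moment of order `2 j` with variance `x`. -/
def gaussMoment (j : ℕ) (x : ℝ) : ℝ := (Nat.factorial (2 * j) : ℝ) * ((x / 2) ^ j / Nat.factorial j)

theorem CkrEven_mul_pow (n : ℕ) (r : Fin n → ℕ) (j : ℕ) (x : ℝ) :
    CkrEven n r (2 * j) * x ^ (2 * j / 2) =
      gaussMoment j ((splitDelta n r - splitDelta n r ^ 2) * x) := by
  have : 2 * j / 2 = j := by omega
  rw [CkrEven, gaussMoment, this, div_pow, mul_pow]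
  field_simp

theorem gaussMoment_pos (j : ℕ) {x : ℝ} (hx : 0 < x) : 0 < gaussMoment j x := by
  unfold gaussMoment; positivity

theorem abs_gaussMoment_sub_le {x y e : ℝ} {j : ℕ} (hx : 0 ≤ x) (hy : 0 < y)
    (h : |x - y| ≤ e * y) (hje : j * e ≤ 1) :
    |gaussMoment j x - gaussMoment j y| ≤ 2 * (j * e) * gaussMoment j y := by
  have hρ : |x / y - 1| ≤ e := by
    rw [div_sub_one hy.ne', abs_div, abs_of_pos hy, div_le_iff₀ hy]
    exact h
  have h1 := abs_pow_sub_one_le (div_nonneg hx hy.le) hρ hje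
  have e1 : gaussMoment j x - gaussMoment j y = ((x / y) ^ j - 1) * gaussMoment j y := by
    unfold gaussMoment
    rw [div_pow, div_pow, div_pow]
    field_simp
  rw [e1, abs_mul, abs_of_pos (gaussMoment_pos j hy)]
  gcongr
  exact (gaussMoment_pos j hy).le

theorem half_pow_le_gaussMoment_div {j : ℕ} (hj : 1 ≤ j) {v x : ℝ} (hv : 0 < v) (hx : 1 ≤ x) :
    (v / 2) ^ j ≤ gaussMoment j (v * x) / x := by
  rw [le_div_iff₀ (by linarith)]
  unfold gaussMoment
  have h1 : (1 : ℝ) ≤ (Nat.factorial (2 * j) : ℝ) / Nat.factorial j := by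
    rw [one_le_div (by positivity)]
    exact_mod_cast Nat.factorial_le (by omega)
  have h2 : x ≤ x ^ j := le_self_pow₀ hx (by omega)
  have e : (Nat.factorial (2 * j) : ℝ) * ((v * x / 2) ^ j / Nat.factorial j) =
      (Nat.factorial (2 * j) : ℝ) / Nat.factorial j * ((v / 2) ^ j * x ^ j) := by
    rw [← mul_pow]; ring
  rw [e]
  calc (v / 2) ^ j * x ≤ (v / 2) ^ j * x ^ j := by gcongr
    _ ≤ _ := le_mul_of_one_le_left (by positivity) h1

/-- The arithmetic error terms are negligible once `N` exceeds a large power of `z ^ k`. -/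
theorem pow_mul_rpow_le {v c z : ℝ} {N k : ℕ} (hv : 0 < v) (hv1 : v ≤ 1)
    (hc1 : c * (8 * (2 + Real.log (2 / v))) ≤ 1) (hz : 3 ≤ z) (hN : 1 ≤ N)
    (hk : (k : ℝ) ≤ c * (Real.log N / Real.log z)) :
    z ^ (2 * k) * (N : ℝ) ^ (-(1 / 8) : ℝ) ≤ (v / 2) ^ k := by
  have hl := one_le_log hz
  have hz0 : (0 : ℝ) < z := by linarith
  have hN0 : (0 : ℝ) < N := by exact_mod_cast hN
  have hB : 0 ≤ Real.log (2 / v) := Real.log_nonneg (by rw [le_div_iff₀ hv]; linarith)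
  set B := Real.log (2 / v) with hBdef
  have e1 : z ^ (2 * k) = Real.exp (2 * k * Real.log z) := by
    rw [← Real.rpow_natCast, Real.rpow_def_of_pos hz0]; push_cast; ring_nf
  have e2 : (N : ℝ) ^ (-(1 / 8) : ℝ) = Real.exp (-(Real.log N / 8)) := by
    rw [Real.rpow_def_of_pos hN0]; ring_nf
  have e3 : (v / 2) ^ k = Real.exp (-(k * B)) := by
    rw [hBdef, ← mul_neg, ← Real.log_inv, inv_div, Real.exp_nat_mul, Real.exp_log (by positivity)]
  rw [e1, e2, e3, ← Real.exp_add]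
  apply Real.exp_le_exp.mpr
  have hk0 : (0 : ℝ) ≤ k := Nat.cast_nonneg k
  have h1 : k * Real.log z ≤ c * Real.log N := by
    rw [← mul_div_assoc, le_div_iff₀ (by linarith)] at hk
    exact hk
  have hlN : 0 ≤ Real.log N := Real.log_natCast_nonneg N
  have h2 : 8 * (2 + B) * (k * Real.log z) ≤ Real.log N :=
    calc 8 * (2 + B) * (k * Real.log z) ≤ 8 * (2 + B) * (c * Real.log N) := by gcongr
      _ = c * (8 * (2 + B)) * Real.log N := by ring
      _ ≤ 1 * Real.log N := by gcongr
      _ = _ := one_mul _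
  have h3 : k * B ≤ B * (k * Real.log z) := by
    have : 0 ≤ k * B := by positivity
    nlinarith
  linarith

set_option maxHeartbeats 1000000 in
/-- The moment estimate in the range where the number of primes dominates `k ^ 3 * log log z`. -/
theorem abs_expN_moment_sub_le {n : ℕ} (hn : 2 ≤ n) (r : Fin n → ℕ) {C₀ D v τ c z : ℝ}
    (hC₀ : 0 < C₀) (hD : 0 < D) (hv : 0 < v) (hv1 : v ≤ 1)
    (hτ1 : τ ≤ v * Real.log (Real.log 3) / 2) (hτ2 : D * τ ≤ v)
    (hc1 : c * (8 * (2 + Real.log (2 / v))) ≤ 1)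
    (hz : 3 ≤ z) {N j : ℕ} (hN : 1 ≤ N) (hj : 1 ≤ j)
    (hP : ((coeffBox n N \ P0 n N).card : ℝ) ≤
      C₀ * (N : ℝ) ^ (-(1 / 8) : ℝ) * (2 * N + 1 : ℝ) ^ n)
    (hV : |totalVar n r z - v * primePi z| ≤ D * Real.log (Real.log z))
    (hk1 : ((2 * j : ℕ) : ℝ) ^ 3 * Real.log (Real.log z) ≤ τ * primePi z)
    (hk2 : ((2 * j : ℕ) : ℝ) ≤ c * (Real.log N / Real.log z)) :
    |expN n N (fun f => (∑ p ∈ primesTo z, Yp n r p f) ^ (2 * j)) -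
        gaussMoment j (v * primePi z)| ≤
      (54 / (v * Real.log (Real.log 3)) + D / v + (n + 2 * C₀) / Real.log (Real.log 3)) *
        (gaussMoment j (v * primePi z) * (((2 * j : ℕ) : ℝ) ^ 3) *
          (Real.log (Real.log z) / primePi z)) := by
  have hℓ := loglog_three_pos
  have hL := loglog_ge hz
  set ℓ := Real.log (Real.log 3)
  set L := Real.log (Real.log z)
  have hL0 : 0 < L := hℓ.trans_le hL
  have hl := one_le_log hz
  have hz0 : (0 : ℝ) < z := by linarith
  have hN0 : (0 : ℝ) < N := by exact_mod_cast hN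
  have hπ0 : (0 : ℝ) < primePi z := lt_of_lt_of_le (by positivity) (primePi_ge hz)
  have hπ1 : (1 : ℝ) ≤ primePi z := by
    have : 0 < primePi z := by exact_mod_cast hπ0
    exact_mod_cast this
  have hπz := primePi_le hz0.le
  set Q : ℝ := (primePi z : ℝ)
  have hK2 : (2 : ℝ) ≤ ((2 * j : ℕ) : ℝ) := by exact_mod_cast (by omega : 2 ≤ 2 * j)
  have hjK : ((2 * j : ℕ) : ℝ) = 2 * j := by push_cast; ring
  set K : ℝ := ((2 * j : ℕ) : ℝ)
  have hK3 : 8 ≤ K ^ 3 := by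
    calc (8 : ℝ) = 2 ^ 3 := by norm_num
      _ ≤ K ^ 3 := by gcongr
  have hKK3 : K ≤ K ^ 3 := le_self_pow₀ (by linarith) (by norm_num)
  set T := totalVar n r z
  have hT := abs_le.mp hV
  have hDL : D * L ≤ v * Q / 8 := by
    have h1 : 8 * L ≤ τ * Q := (mul_le_mul_of_nonneg_right hK3 hL0.le).trans hk1
    have h2 : D * (8 * L) ≤ D * (τ * Q) := by gcongr
    have h3 : D * τ * Q ≤ v * Q := by gcongr
    linarith
  have hvQ : 0 < v * Q := by positivity
  have hThalf : v * Q / 2 ≤ T := by linarith [hT.1]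
  have hT0 : 0 < T := by linarith
  have hK3T : K ^ 3 ≤ T := by
    refine le_trans ?_ hThalf
    have h1 : K ^ 3 * ℓ ≤ v * ℓ / 2 * Q := by
      calc K ^ 3 * ℓ ≤ K ^ 3 * L := by gcongr
        _ ≤ τ * Q := hk1
        _ ≤ _ := by gcongr
    have : K ^ 3 * ℓ ≤ v * Q / 2 * ℓ := by linarith
    exact le_of_mul_le_mul_right this hℓ
  set M := gaussMoment j (v * Q)
  have hM : 0 < M := gaussMoment_pos j hvQ
  set E := K ^ 3 * (L / Q) with hE
  have hE0 : 0 < E := by positivity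
  -- comparison of Gaussian moments
  have hje : j * (D * L / (v * Q)) ≤ 1 ∧ 2 * (j * (D * L / (v * Q))) ≤ D / v * E := by
    have e : 2 * (j * (D * L / (v * Q))) = D / v * (K * (L / Q)) := by rw [hjK]; field_simp
    have h2 : 2 * (j * (D * L / (v * Q))) ≤ D / v * E := by
      rw [e, hE]; gcongr
    refine ⟨?_, h2⟩
    have h3 : E ≤ τ := by rw [hE, ← mul_div_assoc, div_le_iff₀ hπ0]; exact hk1
    have h4 : D / v * E ≤ 1 := by
      calc D / v * E ≤ D / v * τ := by gcongr
        _ = D * τ / v := by ring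
        _ ≤ 1 := by rw [div_le_one hv]; exact hτ2
    have : 0 ≤ j * (D * L / (v * Q)) := by positivity
    linarith
  have hG : |gaussMoment j T - M| ≤ D / v * E * M := by
    refine (abs_gaussMoment_sub_le hT0.le hvQ (e := D * L / (v * Q)) ?_ hje.1).trans ?_
    · rw [div_mul_cancel₀ _ hvQ.ne']; exact hV
    · exact mul_le_mul_of_nonneg_right hje.2 hM.le
  have hGT : gaussMoment j T ≤ 3 * M := by
    have h1 := (abs_gaussMoment_sub_le hT0.le hvQ (e := D * L / (v * Q))
      (by rw [div_mul_cancel₀ _ hvQ.ne']; exact hV) hje.1)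
    have h2 := (abs_le.mp h1).2
    have h3 : 2 * (j * (D * L / (v * Q))) * M ≤ 2 * M := by gcongr; linarith [hje.1]
    linarith
  -- the box moment
  have hbox := box_even_moment (n := n) (N := N) hN r (z := z) (by linarith)
    (by linarith : 8 ≤ totalVar n r z) hj hK3T
  have hbox' : |boxAvg n N (fun a => (∑ p ∈ primesTo z, Yp n r p a) ^ (2 * j)) - gaussMoment j T| ≤
      54 / (v * ℓ) * E * M + n * (z ^ (2 * (2 * j)) * (N : ℝ) ^ (-(1 / 8) : ℝ)) := by
    refine hbox.trans (add_le_add ?_ ?_)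
    · have e : (Nat.factorial (2 * j) : ℝ) * (9 * (K ^ 3 / T) * ((T / 2) ^ j / Nat.factorial j)) =
          9 * (K ^ 3 / T) * gaussMoment j T := by unfold gaussMoment; ring
      refine e.le.trans ?_
      have h1 : K ^ 3 / T ≤ 2 / (v * ℓ) * E := by
        rw [div_le_iff₀ hT0]
        calc K ^ 3 = 2 / (v * ℓ) * (K ^ 3 * (ℓ / Q)) * (v * Q / 2) := by field_simp
          _ ≤ 2 / (v * ℓ) * E * T := by rw [hE]; gcongr
      calc 9 * (K ^ 3 / T) * gaussMoment j T ≤ 9 * (2 / (v * ℓ) * E) * (3 * M) := by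
            gcongr
            exact (gaussMoment_pos j hT0).le
        _ = _ := by ring
    · have h1 : Q ^ (2 * j) ≤ z ^ (2 * j) := by gcongr
      have h2 : 1 / (N : ℝ) ≤ (N : ℝ) ^ (-(1 / 8) : ℝ) := by
        rw [one_div, ← Real.rpow_neg_one]
        exact Real.rpow_le_rpow_of_exponent_le (by exact_mod_cast hN) (by norm_num)
      calc Q ^ (2 * j) * (n * z ^ (2 * j) / N)
          ≤ z ^ (2 * j) * (n * z ^ (2 * j) / N) := by gcongr
        _ = n * (z ^ (2 * (2 * j)) * (1 / N)) := by rw [two_mul (2 * j), pow_add]; ring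
        _ ≤ _ := by gcongr
  -- passing to the `S_n`-polynomials
  have hexp := abs_expN_sub_boxAvg_le (N := N)
    (F := fun a => (∑ p ∈ primesTo z, Yp n r p a) ^ (2 * j))
    (fun a => abs_sum_Yp_pow_le n r hz0.le a (2 * j)) (P0_nonempty hn hN)
  have hexp' : |expN n N (fun f => (∑ p ∈ primesTo z, Yp n r p f) ^ (2 * j)) -
      boxAvg n N (fun f => (∑ p ∈ primesTo z, Yp n r p f) ^ (2 * j))| ≤
      2 * C₀ * (z ^ (2 * (2 * j)) * (N : ℝ) ^ (-(1 / 8) : ℝ)) := by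
    refine hexp.trans ?_
    have h1 : ((coeffBox n N \ P0 n N).card : ℝ) / (2 * N + 1 : ℝ) ^ n ≤
        C₀ * (N : ℝ) ^ (-(1 / 8) : ℝ) := by
      rw [div_le_iff₀ (by positivity)]; exact hP
    have h2 : z ^ (2 * j) ≤ z ^ (2 * (2 * j)) := pow_le_pow_right₀ (by linarith) (by omega)
    calc _ ≤ 2 * z ^ (2 * (2 * j)) * (C₀ * (N : ℝ) ^ (-(1 / 8) : ℝ)) := by gcongr
      _ = _ := by ring
  have hsmall : z ^ (2 * (2 * j)) * (N : ℝ) ^ (-(1 / 8) : ℝ) ≤ 1 / ℓ * (E * M) := by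
    have h1 := pow_mul_rpow_le (k := 2 * j) hv hv1 hc1 hz hN hk2
    have h2 : (v / 2) ^ (2 * j) ≤ (v / 2) ^ j :=
      pow_le_pow_of_le_one (by positivity) (by linarith) (by omega)
    have h3 := half_pow_le_gaussMoment_div hj hv hπ1
    have h4 : 1 ≤ 1 / ℓ * (K ^ 3 * L) := by
      rw [one_div_mul_eq_div, one_le_div hℓ]
      exact hL.trans (le_mul_of_one_le_left hL0.le (by linarith))
    calc _ ≤ M / Q := h1.trans (h2.trans h3)
      _ ≤ M / Q * (1 / ℓ * (K ^ 3 * L)) := le_mul_of_one_le_right (by positivity) h4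
      _ = _ := by rw [hE]; ring
  set A := z ^ (2 * (2 * j)) * (N : ℝ) ^ (-(1 / 8) : ℝ)
  have hn0 : (0 : ℝ) ≤ n + 2 * C₀ := by positivity
  have h5 := mul_le_mul_of_nonneg_left hsmall hn0
  have htri := (abs_sub_le _ _ M).trans (add_le_add hexp' ((abs_sub_le _ _ M).trans
    (add_le_add hbox' hG)))
  refine htri.trans ?_
  have e : (54 / (v * ℓ) + D / v + (n + 2 * C₀) / ℓ) * (M * K ^ 3 * (L / Q)) =
      54 / (v * ℓ) * E * M + D / v * E * M + (n + 2 * C₀) * (1 / ℓ * (E * M)) := by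
    rw [hE]; ring
  rw [e]
  linarith

/-- **Lemma 3.3, even case**: uniformly for even `k ≪_{n,r} min((z/(log z·log log z))^{1/3}, log N/log z)`,
`𝔼_N((Σ_{p ≤ z} Y_p(f))^k) = C_{k,r}·π(z)^{k/2}·(1 + O_{n,r}(k³/(1−δ(r))^{k/2}·(log log z)/π(z))) + O_n(z^{k(n+1)}/(N·log z))`. -/
theorem moments_Yp_even (n : ℕ) (hn : 2 ≤ n) (r : Fin n → ℕ)
    (hr : ∑ i : Fin n, ((i : ℕ) + 1) * r i = n) :
    ∃ c > (0 : ℝ), ∃ C > (0 : ℝ), ∀ z : ℝ, 3 ≤ z → ∀ N : ℕ, 2 < N → ∀ k : ℕ, Even k →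
      (k : ℝ) ≤ c * min ((z / (Real.log z * Real.log (Real.log z))) ^ ((1 : ℝ) / 3))
          (Real.log (N : ℝ) / Real.log z) →
      |expN n N (fun f =>
          (∑ p ∈ (Finset.range (⌊z⌋₊ + 1)).filter Nat.Prime, Yp n r p f) ^ k) -
        CkrEven n r k * (primePi z : ℝ) ^ (k / 2)| ≤
      C * (CkrEven n r k * (primePi z : ℝ) ^ (k / 2) *
            ((k : ℝ) ^ 3 / (1 - splitDelta n r) ^ (k / 2)) *
            (Real.log (Real.log z) / (primePi z : ℝ)) +
          z ^ (k * (n + 1)) / ((N : ℝ) * Real.log z)) := by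
  have hδ0 := splitDelta_pos n r
  have hδ1 := splitDelta_lt_one hn hr
  have hℓ := loglog_three_pos
  obtain ⟨C₀, hC₀, hP⟩ := exists_card_sdiff_P0_le hn
  obtain ⟨D, hD, hV⟩ := abs_sum_sub_le_of_near (locVar_near hn hr)
  set δ := splitDelta n r
  set v := δ - δ ^ 2 with hvdef
  have hv : 0 < v := by rw [hvdef]; nlinarith
  have hv1 : v ≤ 1 := by rw [hvdef]; nlinarith
  set ℓ := Real.log (Real.log 3)
  have hB : 0 ≤ Real.log (2 / v) := Real.log_nonneg (by rw [le_div_iff₀ hv]; linarith)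
  set τ := min (v * ℓ / 2) (v / D) with hτdef
  have hτ : 0 < τ := lt_min (by positivity) (by positivity)
  have hτ1 : τ ≤ v * ℓ / 2 := min_le_left _ _
  have hτ2 : D * τ ≤ v := by
    rw [mul_comm, ← le_div_iff₀ hD]; exact min_le_right _ _
  set c := min 1 (min (τ / 16) (1 / (8 * (2 + Real.log (2 / v))))) with hcdef
  have hc : 0 < c := lt_min one_pos (lt_min (by positivity) (by positivity))
  have hc1 : c ≤ 1 := min_le_left _ _
  have hc2 : c ≤ τ / 16 := (min_le_right _ _).trans (min_le_left _ _)
  have hc3 : c * (8 * (2 + Real.log (2 / v))) ≤ 1 := by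
    rw [← le_div_iff₀ (by positivity)]; exact (min_le_right _ _).trans (min_le_right _ _)
  refine ⟨c, hc, 54 / (v * ℓ) + D / v + (n + 2 * C₀) / ℓ, by positivity, ?_⟩
  intro z hz N hN k hk hkle
  obtain ⟨j, rfl⟩ := hk.two_dvd
  have hl := one_le_log hz
  have hz0 : (0 : ℝ) < z := by linarith
  have hN0 : (0 : ℝ) < N := by exact_mod_cast (by omega : 0 < N)
  have hL : 0 < Real.log (Real.log z) := hℓ.trans_le (loglog_ge hz)
  have hπ := primePi_ge hz
  have hπ0 : (0 : ℝ) < primePi z := lt_of_lt_of_le (by positivity) hπ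
  rw [CkrEven_mul_pow]
  change |expN n N (fun f => (∑ p ∈ primesTo z, Yp n r p f) ^ (2 * j)) -
    gaussMoment j (v * primePi z)| ≤ _
  have hM : 0 < gaussMoment j (v * primePi z) := gaussMoment_pos j (by positivity)
  have hlast : 0 ≤ z ^ (2 * j * (n + 1)) / (N * Real.log z) := by positivity
  have hden : 0 < (1 - δ) ^ (2 * j / 2) := pow_pos (by linarith) _
  rcases Nat.eq_zero_or_pos j with rfl | hj
  · have h1 : (0 : ℝ) < (P0 n N).card := by exact_mod_cast (P0_nonempty hn (by omega)).card_pos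
    have : expN n N (fun f => (∑ p ∈ primesTo z, Yp n r p f) ^ (2 * 0)) -
        gaussMoment 0 (v * primePi z) = 0 := by
      simp [expN, gaussMoment, div_self h1.ne']
    rw [this, abs_zero]
    positivity
  have hk1 : ((2 * j : ℕ) : ℝ) ^ 3 * Real.log (Real.log z) ≤ τ * primePi z := by
    have h1 := hkle.trans (mul_le_mul_of_nonneg_left (min_le_left _ _) hc.le)
    have hx : 0 ≤ z / (Real.log z * Real.log (Real.log z)) := by positivity
    have h2 : ((2 * j : ℕ) : ℝ) ^ 3 ≤ c ^ 3 * (z / (Real.log z * Real.log (Real.log z))) := by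
      calc ((2 * j : ℕ) : ℝ) ^ 3 ≤ _ := pow_le_pow_left₀ (Nat.cast_nonneg _) h1 3
        _ = _ := by
          rw [mul_pow, ← Real.rpow_natCast (_ ^ (1 / 3 : ℝ)), ← Real.rpow_mul hx]
          norm_num
    have h3 : c ^ 3 ≤ τ / 16 := (pow_le_of_le_one hc.le hc1 (by norm_num)).trans hc2
    calc ((2 * j : ℕ) : ℝ) ^ 3 * Real.log (Real.log z)
        ≤ τ / 16 * (z / (Real.log z * Real.log (Real.log z))) * Real.log (Real.log z) := by
          gcongr
          exact h2.trans (by gcongr)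
      _ = τ * (z / Real.log z / 16) := by field_simp
      _ ≤ τ * primePi z := by gcongr
  have hk2 := hkle.trans (mul_le_mul_of_nonneg_left (min_le_right _ _) hc.le)
  refine (abs_expN_moment_sub_le hn r hC₀ hD hv hv1 hτ1 hτ2 hc3 hz (by omega) hj
    (hP N (by omega)) (hV z hz) hk1 hk2).trans ?_
  apply mul_le_mul_of_nonneg_left _ (by positivity)
  refine le_trans ?_ (le_add_of_nonneg_right hlast)
  gcongr
  exact le_div_self (by positivity) hden (pow_le_one₀ (by linarith) (by linarith))

end
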